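/- arXiv:1110.0708 — 2 statements merged into one kernel-verified Lean document; each statement's English description precedes it below -/
import Mathlib

section
/- Let S be a multiplicative set of positive integers satisfying Condition B with density δ > 0 and exponent ρ > 0, and let γ_S be its Euler–Kronecker constant. Then there is a constant C such that for all x ≥ 2, |Σ_{n≤x} Λ_S(n)/n − δ·log x + γ_S| ≤ C/(log x)^ρ. -/
open Filter Real
open scoped Classical

/-- A set of positive integers is *multiplicative* if `1 ∈ S` and for all coprime
positive integers `m, n` one has `m * n ∈ S ↔ m ∈ S ∧ n ∈ S`. -/
def IsMultiplicativeSet (S : Set ℕ) : Prop :=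
  1 ∈ S ∧ ∀ m n : ℕ, 0 < m → 0 < n → Nat.Coprime m n → (m * n ∈ S ↔ m ∈ S ∧ n ∈ S)

/-- `S(x)`: the number of `n ≤ x` with `n ∈ S`. -/
noncomputable def setCount (S : Set ℕ) (x : ℝ) : ℕ :=
  {n : ℕ | 0 < n ∧ (n : ℝ) ≤ x ∧ n ∈ S}.ncard

/-- `π_S(x)`: the number of primes `p ≤ x` with `p ∈ S`. -/
noncomputable def primeCount (S : Set ℕ) (x : ℝ) : ℕ :=
  {p : ℕ | p.Prime ∧ (p : ℝ) ≤ x ∧ p ∈ S}.ncard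

/-- The characteristic function of `S`. -/
noncomputable def chiS (S : Set ℕ) (n : ℕ) : ℝ := if n ∈ S then 1 else 0

/-- The logarithmic integral `Li(x) = ∫₂ˣ dt / log t`. -/
noncomputable def Li (x : ℝ) : ℝ := ∫ t in (2:ℝ)..x, 1 / Real.log t

/-- Condition B with density `δ` and exponent `ρ`:
`π_S(x) = δ Li(x) + O(x / (log x)^{2+ρ})`. -/
def ConditionB (S : Set ℕ) (δ ρ : ℝ) : Prop :=
  ∃ C : ℝ, ∀ x : ℝ, 2 ≤ x →
    |(primeCount S x : ℝ) - δ * Li x| ≤ C * x / Real.log x ^ (2 + ρ)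

/-- The Dirichlet series `L_S(s) = ∑_{n ∈ S} n^{-s}` of `S` (as a function of a real
variable `s`). -/
noncomputable def LSeries' (S : Set ℕ) (s : ℝ) : ℝ :=
  ∑' n : ℕ, if n ∈ S then (n : ℝ) ^ (-s) else 0

/-- `γS` is the Euler–Kronecker constant of `S` (with density `δ`), i.e.
`L_S'(s)/L_S(s) + δ/(s-1) → γS` as `s → 1⁺`. -/
def IsEulerKronecker (S : Set ℕ) (δ γS : ℝ) : Prop :=
  Tendsto (fun s : ℝ => deriv (LSeries' S) s / LSeries' S s + δ / (s - 1))
    (nhdsWithin 1 (Set.Ioi 1)) (nhds γS)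

/-- The partial Euler-type product
`∏_{p < P, p prime} (1 + χ_S(p)/p + χ_S(p²)/p² + …) (1 - 1/p)^δ`. -/
noncomputable def wirsingProd (S : Set ℕ) (δ : ℝ) (P : ℕ) : ℝ :=
  ∏ p ∈ Finset.filter Nat.Prime (Finset.range P),
    (∑' e : ℕ, chiS S (p ^ e) / (p : ℝ) ^ e) * (1 - 1 / (p : ℝ)) ^ δ

/-- `Λ_S` is the generalized von Mangoldt function of `S`: it vanishes outside prime
powers and satisfies `χ_S(n) log n = ∑_{d ∣ n} χ_S(n/d) Λ_S(d)` for all `n ≥ 1`. -/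
def IsVonMangoldtOf (S : Set ℕ) (ΛS : ℕ → ℝ) : Prop :=
  (∀ n : ℕ, ¬ IsPrimePow n → ΛS n = 0) ∧
  (∀ n : ℕ, 1 ≤ n →
    chiS S n * Real.log n = ∑ d ∈ n.divisors, chiS S (n / d) * ΛS d)

lemma IsVonMangoldtOf.prime_pow_recursion {S : Set ℕ} {ΛS : ℕ → ℝ} (hΛ : IsVonMangoldtOf S ΛS)
    {p : ℕ} (hp : p.Prime) (k : ℕ) :
    (k : ℝ) * chiS S (p ^ k) * Real.log p =
      ∑ j ∈ Finset.range (k + 1), chiS S (p ^ (k - j)) * ΛS (p ^ j) := by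
  have h := hΛ.2 (p ^ k) (Nat.one_le_pow _ _ hp.pos)
  rw [Nat.sum_divisors_prime_pow hp] at h
  rw [mul_comm (k : ℝ), mul_assoc, ← Real.log_pow, ← Nat.cast_pow, h]
  refine Finset.sum_congr rfl fun j hj ↦ ?_
  rw [Nat.pow_div (Nat.lt_succ_iff.mp (Finset.mem_range.mp hj)) hp.pos]

/-- If `F = ∑ aₖ zᵏ` has coefficients in `{0, 1}` and `a₀ = 1`, the coefficients of `z F' / F`
grow at most like `(7/4)ᵏ`. -/
lemma abs_le_of_logDeriv_recursion {a b : ℕ → ℝ} {L : ℝ} (ha0 : a 0 = 1)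
    (ha : ∀ k, a k = 0 ∨ a k = 1) (hb0 : b 0 = 0)
    (hrec : ∀ k : ℕ, (k : ℝ) * a k * L = ∑ j ∈ Finset.range (k + 1), a (k - j) * b j)
    (hL : 0 ≤ L) (k : ℕ) : |b k| ≤ 4 * L * (7 / 4) ^ k := by
  have key (m : ℕ) : |b (m + 2)| ≤ (m + 2) * L + ∑ j ∈ Finset.range (m + 1), |b j| := by
    have h2 := hrec (m + 2)
    rw [Finset.sum_range_succ, Finset.sum_range_succ] at h2
    have e1 : m + 2 - (m + 1) = 1 := by omega
    simp only [Nat.sub_self, ha0, one_mul, e1] at h2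
    push_cast at h2
    have a01 (i : ℕ) : 0 ≤ a i ∧ a i ≤ 1 := by rcases ha i with h | h <;> simp [h]
    rcases ha 1 with h1 | h1
    · rw [h1, zero_mul, add_zero] at h2
      have hs : |∑ j ∈ Finset.range (m + 1), a (m + 2 - j) * b j| ≤
          ∑ j ∈ Finset.range (m + 1), |b j| := by
        refine (Finset.abs_sum_le_sum_abs _ _).trans (Finset.sum_le_sum fun j _ ↦ ?_)
        rw [abs_mul, abs_of_nonneg (a01 _).1]
        exact mul_le_of_le_one_left (abs_nonneg _) (a01 _).2
      have hm : 0 ≤ (m + 2 : ℝ) * L := by positivity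
      have h3 : (m + 2 : ℝ) * a (m + 2) * L ≤ (m + 2) * L := by
        nlinarith [(a01 (m + 2)).2]
      have h4 : 0 ≤ (m + 2 : ℝ) * a (m + 2) * L := by
        have := (a01 (m + 2)).1; positivity
      rw [abs_le] at hs ⊢
      constructor <;> linarith [hs.1, hs.2]
    · have h3 := hrec (m + 1)
      rw [Finset.sum_range_succ] at h3
      simp only [Nat.sub_self, ha0, one_mul] at h3
      push_cast at h3
      rw [h1, one_mul] at h2
      have hd : ∑ j ∈ Finset.range (m + 1), (a (m + 2 - j) - a (m + 1 - j)) * b j =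
          ∑ j ∈ Finset.range (m + 1), a (m + 2 - j) * b j -
          ∑ j ∈ Finset.range (m + 1), a (m + 1 - j) * b j := by
        rw [← Finset.sum_sub_distrib]; exact Finset.sum_congr rfl fun j _ ↦ by ring
      have hs : |∑ j ∈ Finset.range (m + 1), (a (m + 2 - j) - a (m + 1 - j)) * b j| ≤
          ∑ j ∈ Finset.range (m + 1), |b j| := by
        refine (Finset.abs_sum_le_sum_abs _ _).trans (Finset.sum_le_sum fun j _ ↦ ?_)
        rw [abs_mul]
        refine mul_le_of_le_one_left (abs_nonneg _) (abs_le.mpr ⟨?_, ?_⟩) <;>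
          linarith [(a01 (m + 2 - j)).1, (a01 (m + 2 - j)).2, (a01 (m + 1 - j)).1,
            (a01 (m + 1 - j)).2]
      have hm : 0 ≤ (m + 1 : ℝ) * L := by positivity
      have hm' : 0 ≤ (m + 2 : ℝ) * L := by positivity
      have h4 : |(m + 2 : ℝ) * a (m + 2) * L - (m + 1) * a (m + 1) * L| ≤ (m + 2) * L := by
        rw [abs_le]
        rcases ha (m + 2) with h | h <;> rcases ha (m + 1) with h' | h' <;> rw [h, h'] <;>
          constructor <;> linarith
      rw [abs_le] at hs h4 ⊢
      constructor <;> linarith [hs.1, hs.2, h4.1, h4.2]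
  induction k using Nat.strong_induction_on with
  | _ k ih =>
    match k with
    | 0 => simp [hb0]; positivity
    | 1 =>
      have h := hrec 1
      simp [Finset.sum_range_succ, ha0, hb0] at h
      rw [← h, pow_one]
      rcases ha 1 with h1 | h1 <;> simp [h1, abs_of_nonneg hL] <;> linarith
    | m + 2 =>
      have hs : ∑ j ∈ Finset.range (m + 1), |b j| ≤
          ∑ j ∈ Finset.range (m + 1), 4 * L * (7 / 4 : ℝ) ^ j :=
        Finset.sum_le_sum fun j hj ↦ ih j (by have := Finset.mem_range.mp hj; omega)
      rw [← Finset.mul_sum, geom_sum_eq (by norm_num)] at hs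
      have hB := one_add_mul_le_pow (a := (3 / 4 : ℝ)) (by norm_num) (m + 1)
      norm_num at hB hs
      have e : (7 / 4 : ℝ) ^ (m + 2) = 7 / 4 * (7 / 4) ^ (m + 1) := by ring
      have := key m
      rw [e]
      nlinarith [mul_le_mul_of_nonneg_left hB hL, (Nat.cast_nonneg m : (0 : ℝ) ≤ m),
        mul_nonneg (Nat.cast_nonneg m : (0 : ℝ) ≤ m) hL]

lemma IsVonMangoldtOf.abs_prime_pow_le {S : Set ℕ} {ΛS : ℕ → ℝ} (hΛ : IsVonMangoldtOf S ΛS)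
    (h1 : 1 ∈ S) {p : ℕ} (hp : p.Prime) (k : ℕ) :
    |ΛS (p ^ k)| ≤ 4 * Real.log p * (7 / 4) ^ k := by
  refine abs_le_of_logDeriv_recursion (a := fun k ↦ chiS S (p ^ k)) (b := fun k ↦ ΛS (p ^ k))
    (by simp [chiS, h1]) (fun k ↦ ?_) ?_ (hΛ.prime_pow_recursion hp)
    (Real.log_natCast_nonneg p) k
  · simp only [chiS]; split_ifs <;> simp
  · simpa using hΛ.1 1 not_isPrimePow_one

lemma IsVonMangoldtOf.apply_prime {S : Set ℕ} {ΛS : ℕ → ℝ} (hΛ : IsVonMangoldtOf S ΛS)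
    (h1 : 1 ∈ S) {p : ℕ} (hp : p.Prime) : ΛS p = chiS S p * Real.log p := by
  have h := hΛ.prime_pow_recursion hp 1
  simp [Finset.sum_range_succ, hΛ.1 1 not_isPrimePow_one] at h
  rw [h]
  simp [chiS, h1]

/-- The restriction of `f` to non-primes. -/
noncomputable def nonprimePart (f : ℕ → ℝ) (n : ℕ) : ℝ := if n.Prime then 0 else f n

lemma summable_log_mul_rpow_primes :
    Summable fun p : Nat.Primes ↦ Real.log (p : ℕ) * ((p : ℕ) : ℝ) ^ (-(9 / 5) : ℝ) := by
  have h : Summable fun n : ℕ ↦ 2 * (n : ℝ) ^ (-(13 / 10) : ℝ) :=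
    (Real.summable_nat_rpow.mpr (by norm_num)).mul_left 2
  refine Summable.of_nonneg_of_le (fun p ↦ ?_) (fun p ↦ ?_)
    (h.comp_injective Subtype.val_injective)
  · have := Real.log_natCast_nonneg (p : ℕ); positivity
  · have hp : (0 : ℝ) < (p : ℕ) := by exact_mod_cast p.2.pos
    have h1 := Real.log_le_rpow_div hp.le (show (0 : ℝ) < 1 / 2 by norm_num)
    calc Real.log (p : ℕ) * ((p : ℕ) : ℝ) ^ (-(9 / 5) : ℝ)
        ≤ (((p : ℕ) : ℝ) ^ (1 / 2 : ℝ) / (1 / 2)) * ((p : ℕ) : ℝ) ^ (-(9 / 5) : ℝ) := by gcongr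
      _ = 2 * (((p : ℕ) : ℝ) ^ (1 / 2 : ℝ) * ((p : ℕ) : ℝ) ^ (-(9 / 5) : ℝ)) := by ring
      _ = 2 * ((p : ℕ) : ℝ) ^ (-(13 / 10) : ℝ) := by rw [← Real.rpow_add hp]; norm_num

lemma seven_div_four_mul_two_rpow_lt_one : (7 / 4 : ℝ) * 2 ^ (-(9 / 10) : ℝ) < 1 := by
  have h : (7 / 4 : ℝ) < 2 ^ (9 / 10 : ℝ) := by
    refine lt_of_pow_lt_pow_left₀ 10 (by positivity) ?_
    rw [← Real.rpow_natCast (2 ^ (9 / 10 : ℝ)), ← Real.rpow_mul (by norm_num)]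
    norm_num
  rw [Real.rpow_neg (by norm_num), ← div_eq_mul_inv, div_lt_one (by positivity)]
  exact h

lemma IsVonMangoldtOf.summable_nonprimePart {S : Set ℕ} {ΛS : ℕ → ℝ}
    (hΛ : IsVonMangoldtOf S ΛS) (h1 : 1 ∈ S) :
    Summable fun n : ℕ ↦ |nonprimePart ΛS n| * (n : ℝ) ^ (-(9 / 10) : ℝ) := by
  set q : ℝ := 7 / 4 * 2 ^ (-(9 / 10) : ℝ) with hq
  have hi : Function.Injective (fun x : Nat.Primes × ℕ ↦ (Nat.Primes.prodNatEquiv x : ℕ)) :=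
    Subtype.val_injective.comp (Equiv.injective _)
  rw [← hi.summable_iff]
  · have hgeo : Summable fun k : ℕ ↦ 49 / 4 * q ^ (k - 1) := by
      rw [← summable_nat_add_iff 1]
      exact (summable_geometric_of_lt_one (by positivity)
        seven_div_four_mul_two_rpow_lt_one).mul_left _
    have hB (p : Nat.Primes) :
        0 ≤ Real.log (p : ℕ) * ((p : ℕ) : ℝ) ^ (-(9 / 5) : ℝ) := by
      have := Real.log_natCast_nonneg (p : ℕ); positivity
    refine Summable.of_nonneg_of_le
      (fun x ↦ mul_nonneg (abs_nonneg _) (Real.rpow_nonneg (Nat.cast_nonneg _) _)) ?_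
      (summable_log_mul_rpow_primes.mul_of_nonneg hgeo hB fun k ↦
        show (0 : ℝ) ≤ 49 / 4 * q ^ (k - 1) by positivity)
    rintro ⟨p, k⟩
    have hp := p.2
    simp only [Function.comp_apply, Nat.Primes.coe_prodNatEquiv_apply]
    obtain _ | m := k
    · simp only [nonprimePart, zero_add, pow_one, hp, if_true, abs_zero, zero_mul]
      have := hB p
      positivity
    · have hnp : ¬ ((p : ℕ) ^ (m + 1 + 1)).Prime := Nat.Prime.not_prime_pow (by omega)
      simp only [nonprimePart, hnp, if_false, Nat.add_sub_cancel]
      have hp0 : (0 : ℝ) < (p : ℕ) := by exact_mod_cast hp.pos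
      have hp2 : (2 : ℝ) ≤ (p : ℕ) := by exact_mod_cast hp.two_le
      have e : (((p : ℕ) ^ (m + 1 + 1) : ℕ) : ℝ) ^ (-(9 / 10) : ℝ) =
          ((p : ℕ) : ℝ) ^ (-(9 / 5) : ℝ) * (((p : ℕ) : ℝ) ^ (-(9 / 10) : ℝ)) ^ m := by
        rw [Nat.cast_pow, ← Real.rpow_natCast, ← Real.rpow_natCast, ← Real.rpow_mul hp0.le,
          ← Real.rpow_mul hp0.le, ← Real.rpow_add hp0]
        congr 1; push_cast; ring
      have e2 : (((p : ℕ) : ℝ) ^ (-(9 / 10) : ℝ)) ^ m ≤ (2 ^ (-(9 / 10) : ℝ)) ^ m :=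
        pow_le_pow_left₀ (by positivity)
          (Real.rpow_le_rpow_of_nonpos (by norm_num) hp2 (by norm_num)) m
      have hlog := Real.log_natCast_nonneg (p : ℕ)
      rw [e]
      calc _ ≤ (4 * Real.log (p : ℕ) * (7 / 4) ^ (m + 1 + 1)) *
            (((p : ℕ) : ℝ) ^ (-(9 / 5) : ℝ) * (2 ^ (-(9 / 10) : ℝ)) ^ m) := by
              gcongr
              exact hΛ.abs_prime_pow_le h1 hp _
        _ = _ := by rw [hq, mul_pow]; ring
  · intro n hn
    have : ¬ IsPrimePow n := fun h ↦ hn ⟨Nat.Primes.prodNatEquiv.symm ⟨n, h⟩,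
      congrArg Subtype.val (Nat.Primes.prodNatEquiv.apply_symm_apply ⟨n, h⟩)⟩
    simp [nonprimePart, hΛ.1 n this]

/-- Rankin's bound for the tail of a series. -/
lemma abs_sum_div_sub_tsum_le {g : ℕ → ℝ}
    (hg : Summable fun n : ℕ ↦ |g n| * (n : ℝ) ^ (-(9 / 10) : ℝ)) {x : ℝ} (hx : 1 ≤ x) :
    |∑ n ∈ Finset.Icc 1 ⌊x⌋₊, g n / n - ∑' n : ℕ, g n / n| ≤
      (∑' n : ℕ, |g n| * (n : ℝ) ^ (-(9 / 10) : ℝ)) * x ^ (-(1 / 10) : ℝ) := by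
  have hx0 : 0 < x := by linarith
  set t : Finset ℕ := Finset.Icc 1 ⌊x⌋₊ with ht
  set w : ℕ → ℝ := fun n ↦ |g n| * (n : ℝ) ^ (-(9 / 10) : ℝ) with hw
  have hsplit (n : ℕ) (hn : 0 < n) : |g n / n| = w n * (n : ℝ) ^ (-(1 / 10) : ℝ) := by
    have hn' : (0 : ℝ) < n := by exact_mod_cast hn
    rw [hw]
    simp only
    rw [mul_assoc, ← Real.rpow_add hn', abs_div, Nat.abs_cast, div_eq_mul_inv]
    norm_num [Real.rpow_neg_one]
  have hs : Summable fun n : ℕ ↦ |g n / n| := by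
    refine Summable.of_nonneg_of_le (fun _ ↦ abs_nonneg _) (fun n ↦ ?_) hg
    rcases n.eq_zero_or_pos with rfl | hn
    · simp; positivity
    · rw [hsplit n hn]
      have hn1 : (1 : ℝ) ≤ n := by exact_mod_cast hn
      exact mul_le_of_le_one_right (by positivity)
        (Real.rpow_le_one_of_one_le_of_nonpos hn1 (by norm_num))
  have hpt (n : {n : ℕ // n ∉ t}) : |g n / (n : ℕ)| ≤ w n * x ^ (-(1 / 10) : ℝ) := by
    obtain ⟨n, hn⟩ := n
    rcases n.eq_zero_or_pos with rfl | hn0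
    · simp; positivity
    · rw [hsplit n hn0]
      have : ⌊x⌋₊ < n := by
        by_contra h
        exact hn (Finset.mem_Icc.mpr ⟨hn0, not_lt.mp h⟩)
      have hxn : x ≤ n := ((Nat.floor_lt hx0.le).mp this).le
      exact mul_le_mul_of_nonneg_left
        (Real.rpow_le_rpow_of_nonpos hx0 hxn (by norm_num)) (by positivity)
  have hgs : Summable fun n : ℕ ↦ g n / n := hs.of_abs
  rw [← hgs.sum_add_tsum_subtype_compl t, sub_add_cancel_left, abs_neg]
  have hws : Summable fun n : {n : ℕ // n ∉ t} ↦ w n := hg.subtype _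
  calc |∑' n : {n : ℕ // n ∉ t}, g n / (n : ℕ)|
      ≤ ∑' n : {n : ℕ // n ∉ t}, |g n / (n : ℕ)| := by
        simpa only [Real.norm_eq_abs] using norm_tsum_le_tsum_norm
          (f := fun n : {n : ℕ // n ∉ t} ↦ g n / (n : ℕ)) (hs.subtype {n | n ∉ t})
    _ ≤ ∑' n : {n : ℕ // n ∉ t}, w n * x ^ (-(1 / 10) : ℝ) :=
        (hs.subtype _).tsum_le_tsum hpt (hws.mul_right _)
    _ = (∑' n : {n : ℕ // n ∉ t}, w n) * x ^ (-(1 / 10) : ℝ) := tsum_mul_right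
    _ ≤ _ := by
        gcongr
        exact hg.tsum_subtype_le (fun n ↦ w n) {n | n ∉ t} (fun n ↦ by positivity)

/-- Powers of `x` beat powers of `log x`. -/
lemma rpow_neg_le_div_log_rpow {ρ ε x : ℝ} (hρ : 0 < ρ) (hε : 0 < ε) (hx : 1 < x) :
    x ^ (-ε) ≤ (ρ / ε) ^ ρ / Real.log x ^ ρ := by
  have hlog := Real.log_pos hx
  have h := Real.log_le_rpow_div (by linarith : 0 ≤ x) (div_pos hε hρ)
  have h2 : Real.log x ^ ρ ≤ (ρ / ε) ^ ρ * x ^ ε := by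
    calc Real.log x ^ ρ ≤ (x ^ (ε / ρ) / (ε / ρ)) ^ ρ := by gcongr
      _ = (ρ / ε) ^ ρ * x ^ ε := by
        rw [div_eq_mul_inv, inv_div, mul_comm, Real.mul_rpow (by positivity) (by positivity),
          ← Real.rpow_mul (by linarith), div_mul_cancel₀ _ hρ.ne']
  rw [le_div_iff₀ (by positivity), Real.rpow_neg (by linarith), inv_mul_le_iff₀ (by positivity)]
  linarith

lemma primeCount_eq_sum (S : Set ℕ) {t : ℝ} (ht : 0 ≤ t) :
    (primeCount S t : ℝ) =
      ∑ k ∈ Finset.Icc 0 ⌊t⌋₊, if k.Prime then chiS S k else 0 := by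
  have : {p : ℕ | p.Prime ∧ (p : ℝ) ≤ t ∧ p ∈ S} =
      ((Finset.Icc 0 ⌊t⌋₊).filter fun p ↦ p.Prime ∧ p ∈ S : Finset ℕ) := by
    ext p
    simp [Nat.le_floor_iff ht]
    tauto
  rw [primeCount, this, Set.ncard_coe_finset, Finset.card_filter]
  push_cast
  refine Finset.sum_congr rfl fun k _ ↦ ?_
  simp only [chiS]
  split_ifs <;> simp_all

lemma hasDerivAt_log_div_self {t : ℝ} (ht : 0 < t) :
    HasDerivAt (fun t ↦ Real.log t / t) ((1 - Real.log t) / t ^ 2) t := by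
  convert! (Real.hasDerivAt_log ht.ne').div (hasDerivAt_id t) ht.ne' using 1
  simp [ht.ne']

lemma continuousOn_deriv_log_div_self :
    ContinuousOn (fun t : ℝ ↦ (1 - Real.log t) / t ^ 2) (Set.Ioi 0) := by
  refine ContinuousOn.div ?_ (by fun_prop) fun t ht ↦ pow_ne_zero 2 (ne_of_gt ht)
  exact continuousOn_const.sub (Real.continuousOn_log.mono fun t ht ↦ ne_of_gt ht)

lemma continuousOn_one_div_log : ContinuousOn (fun t : ℝ ↦ 1 / Real.log t) (Set.Ioi 1) := by
  refine continuousOn_const.div (Real.continuousOn_log.mono fun t ht ↦ ?_)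
    fun t ht ↦ (Real.log_pos ht).ne'
  exact ne_of_gt (lt_trans one_pos ht)

lemma hasDerivAt_Li {t : ℝ} (ht : 1 < t) : HasDerivAt Li (1 / Real.log t) t := by
  have hI : Set.uIcc 2 t ⊆ Set.Ioi 1 := fun y hy ↦
    lt_of_lt_of_le (lt_min (by norm_num) ht) hy.1
  refine intervalIntegral.integral_hasDerivAt_right
    (continuousOn_one_div_log.mono hI).intervalIntegrable
    (continuousOn_one_div_log.stronglyMeasurableAtFilter isOpen_Ioi t ht)
    (continuousOn_one_div_log.continuousAt (Ioi_mem_nhds ht))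

/-- Integration by parts for `∫ (log t / t) dLi(t)`. -/
lemma log_div_mul_Li_sub_integral {x : ℝ} (hx : 2 ≤ x) :
    Real.log x / x * Li x - ∫ t in (2 : ℝ)..x, (1 - Real.log t) / t ^ 2 * Li t =
      Real.log x - Real.log 2 := by
  have hu : Set.uIcc 2 x ⊆ Set.Ioi 1 := by
    rw [Set.uIcc_of_le hx]; intro t ht; exact lt_of_lt_of_le (by norm_num) ht.1
  have hu0 : Set.uIcc 2 x ⊆ Set.Ioi 0 := fun t ht ↦ lt_trans (one_pos : (0 : ℝ) < 1) (hu ht)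
  have h := intervalIntegral.integral_mul_deriv_eq_deriv_mul
    (fun t ht ↦ hasDerivAt_log_div_self (hu0 ht)) (fun t ht ↦ hasDerivAt_Li (hu ht))
    (continuousOn_deriv_log_div_self.mono hu0).intervalIntegrable
    (continuousOn_one_div_log.mono hu).intervalIntegrable
  have hLi2 : Li 2 = 0 := by simp [Li]
  have h2 : ∫ t in (2 : ℝ)..x, Real.log t / t * (1 / Real.log t) = ∫ t in (2 : ℝ)..x, 1 / t := by
    refine intervalIntegral.integral_congr fun t ht ↦ ?_
    have := (Real.log_pos (hu ht)).ne'
    field_simp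
  rw [h2, integral_one_div_of_pos (by norm_num) (by linarith), hLi2,
    Real.log_div (by linarith) (by norm_num)] at h
  linarith

lemma sum_log_div_eq (S : Set ℕ) {x : ℝ} (hx : 2 ≤ x) :
    ∑ k ∈ Finset.Icc 1 ⌊x⌋₊, (if k.Prime then chiS S k * Real.log k else 0) / k =
      Real.log x / x * primeCount S x -
        ∫ t in (2 : ℝ)..x, (1 - Real.log t) / t ^ 2 * primeCount S t := by
  have hd : ∀ t ∈ Set.Icc 2 x, HasDerivAt (fun t ↦ Real.log t / t)
      ((1 - Real.log t) / t ^ 2) t := fun t ht ↦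
    hasDerivAt_log_div_self (by linarith [ht.1])
  have hsub : Set.Icc 2 x ⊆ Set.Ioi 0 := fun t ht ↦ lt_of_lt_of_le (by norm_num) ht.1
  have hint : MeasureTheory.IntegrableOn (deriv fun t ↦ Real.log t / t) (Set.Icc 2 x) := by
    refine MeasureTheory.IntegrableOn.congr_fun
      (continuousOn_deriv_log_div_self.mono hsub).integrableOn_Icc
      (fun t ht ↦ (hd t ht).deriv.symm) measurableSet_Icc
  have h := sum_mul_eq_sub_integral_mul₁ (fun k ↦ if k.Prime then chiS S k else 0)
    (by simp [Nat.not_prime_zero]) (by simp [Nat.not_prime_one]) x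
    (fun t ht ↦ (hd t ht).differentiableAt) hint
  rw [← primeCount_eq_sum S (by linarith)] at h
  rw [intervalIntegral.integral_of_le hx]
  convert h using 1
  · rw [← Finset.add_sum_Ioc_eq_sum_Icc (Nat.zero_le _)]
    simp only [Nat.not_prime_zero, if_false, mul_zero, zero_add]
    refine Finset.sum_congr rfl fun k _ ↦ ?_
    split_ifs <;> ring
  · congr 1
    refine MeasureTheory.setIntegral_congr_fun measurableSet_Ioc fun t ht ↦ ?_
    rw [(hd t (Set.Ioc_subset_Icc_self ht)).deriv, ← primeCount_eq_sum S (by linarith [ht.1])]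

lemma hasDerivAt_neg_log_rpow_div {ρ t : ℝ} (hρ : 0 < ρ) (ht : 1 < t) :
    HasDerivAt (fun t ↦ -(Real.log t ^ (-ρ) / ρ)) (t⁻¹ * Real.log t ^ (-(1 + ρ))) t := by
  have h := (((Real.hasDerivAt_log (by linarith : t ≠ 0)).rpow_const (p := -ρ)
    (Or.inl (Real.log_pos ht).ne')).div_const ρ).neg
  refine HasDerivAt.congr_deriv h ?_
  rw [show -ρ - 1 = -(1 + ρ) by ring]
  field_simp

lemma tendsto_neg_log_rpow_div {ρ : ℝ} (hρ : 0 < ρ) :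
    Tendsto (fun t ↦ -(Real.log t ^ (-ρ) / ρ)) atTop (nhds 0) := by
  simpa using (((tendsto_rpow_neg_atTop hρ).comp Real.tendsto_log_atTop).div_const ρ).neg

lemma integrableOn_inv_mul_log_rpow {ρ a : ℝ} (hρ : 0 < ρ) (ha : 1 < a) :
    MeasureTheory.IntegrableOn (fun t ↦ t⁻¹ * Real.log t ^ (-(1 + ρ))) (Set.Ioi a) :=
  MeasureTheory.integrableOn_Ioi_deriv_of_nonneg'
    (fun t ht ↦ hasDerivAt_neg_log_rpow_div hρ (lt_of_lt_of_le ha ht))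
    (fun t ht ↦ by
      have : 1 < t := lt_trans ha ht
      have := Real.log_pos this
      positivity)
    (tendsto_neg_log_rpow_div hρ)

lemma integral_inv_mul_log_rpow {ρ a : ℝ} (hρ : 0 < ρ) (ha : 1 < a) :
    ∫ t in Set.Ioi a, t⁻¹ * Real.log t ^ (-(1 + ρ)) = Real.log a ^ (-ρ) / ρ := by
  rw [MeasureTheory.integral_Ioi_of_hasDerivAt_of_tendsto'
    (fun t ht ↦ hasDerivAt_neg_log_rpow_div hρ (lt_of_lt_of_le ha ht))
    (integrableOn_inv_mul_log_rpow hρ ha) (tendsto_neg_log_rpow_div hρ)]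
  ring

lemma aestronglyMeasurable_deriv_mul_primeCount_sub (S : Set ℕ) (δ : ℝ) :
    MeasureTheory.AEStronglyMeasurable
      (fun t ↦ (1 - Real.log t) / t ^ 2 * (primeCount S t - δ * Li t))
      (MeasureTheory.volume.restrict (Set.Ioi 2)) := by
  have h2 : Set.Ioi (2 : ℝ) ⊆ Set.Ioi 1 := Set.Ioi_subset_Ioi (by norm_num)
  have h3 : Set.Ioi (2 : ℝ) ⊆ Set.Ioi 0 := Set.Ioi_subset_Ioi (by norm_num)
  refine ((continuousOn_deriv_log_div_self.mono h3).aestronglyMeasurable measurableSet_Ioi).mul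
    (MeasureTheory.AEStronglyMeasurable.sub ?_ ?_)
  · have hm : Measurable fun t : ℝ ↦
        ∑ k ∈ Finset.Icc 0 ⌊t⌋₊, if k.Prime then chiS S k else 0 :=
      (Measurable.of_discrete (f := fun n : ℕ ↦
        ∑ k ∈ Finset.Icc 0 n, if k.Prime then chiS S k else 0)).comp Nat.measurable_floor
    refine hm.aestronglyMeasurable.congr ?_
    filter_upwards [MeasureTheory.ae_restrict_mem measurableSet_Ioi] with t ht
    exact (primeCount_eq_sum S (h3 ht).le).symm
  · have hc : ContinuousOn Li (Set.Ioi 2) := fun t ht ↦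
      (hasDerivAt_Li (h2 ht)).continuousAt.continuousWithinAt
    exact (continuousOn_const.mul hc).aestronglyMeasurable measurableSet_Ioi

/-- Mertens' theorem for the primes of a set satisfying Condition B. -/
lemma ConditionB.exists_sum_log_div_bound {S : Set ℕ} {δ ρ : ℝ} (hρ : 0 < ρ)
    (hB : ConditionB S δ ρ) :
    ∃ c C : ℝ, ∀ x : ℝ, 2 ≤ x →
      |∑ k ∈ Finset.Icc 1 ⌊x⌋₊, (if k.Prime then chiS S k * Real.log k else 0) / k -
        δ * Real.log x - c| ≤ C / Real.log x ^ ρ := by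
  obtain ⟨C, hC⟩ := hB
  have hC0 : 0 ≤ C := by
    have h := (abs_nonneg _).trans (hC 2 le_rfl)
    have : 0 < Real.log 2 := Real.log_pos (by norm_num)
    by_contra! hneg
    exact absurd h (not_le.mpr (div_neg_of_neg_of_pos (by linarith) (by positivity)))
  have hlog2 : 0 < Real.log 2 := Real.log_pos (by norm_num)
  set E : ℝ → ℝ := fun t ↦ primeCount S t - δ * Li t with hE
  set h : ℝ → ℝ := fun t ↦ (1 - Real.log t) / t ^ 2 * E t with hh
  set K : ℝ := (1 / Real.log 2 + 1) * C with hK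
  have hlog {t : ℝ} (ht : 2 ≤ t) : Real.log 2 ≤ Real.log t :=
    Real.log_le_log (by norm_num) ht
  have hpow {t : ℝ} (ht : 2 ≤ t) :
      Real.log t ^ (2 + ρ) = Real.log t * Real.log t ^ (1 + ρ) := by
    have := hlog2.trans_le (hlog ht)
    rw [show 2 + ρ = 1 + (1 + ρ) by ring, Real.rpow_add this 1, Real.rpow_one]
  have hbound (t : ℝ) (ht : 2 ≤ t) : ‖h t‖ ≤ K * (t⁻¹ * Real.log t ^ (-(1 + ρ))) := by
    have hl := hlog ht
    have hl0 := hlog2.trans_le hl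
    have ht0 : 0 < t := by linarith
    have h1 : |1 - Real.log t| ≤ (1 / Real.log 2 + 1) * Real.log t := by
      have : 1 ≤ 1 / Real.log 2 * Real.log t := by
        rw [one_div_mul_eq_div, one_le_div hlog2]; exact hl
      rw [abs_le]
      constructor <;> nlinarith
    rw [hh, Real.norm_eq_abs, abs_mul, abs_div, abs_of_pos (by positivity : 0 < t ^ 2)]
    calc _ ≤ (1 / Real.log 2 + 1) * Real.log t / t ^ 2 * (C * t / Real.log t ^ (2 + ρ)) := by
          gcongr
          exact hC t ht
      _ = _ := by
          rw [hpow ht, Real.rpow_neg hl0.le, hK]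
          field_simp
  have hint : MeasureTheory.IntegrableOn h (Set.Ioi 2) := by
    refine MeasureTheory.Integrable.mono'
      ((integrableOn_inv_mul_log_rpow hρ (by norm_num : (1 : ℝ) < 2)).const_mul K)
      (aestronglyMeasurable_deriv_mul_primeCount_sub S δ) ?_
    filter_upwards [MeasureTheory.ae_restrict_mem measurableSet_Ioi] with t ht
    exact hbound t (le_of_lt ht)
  refine ⟨-δ * Real.log 2 - ∫ t in Set.Ioi 2, h t, C / Real.log 2 + K / ρ, fun x hx ↦ ?_⟩
  have hl := hlog hx
  have hl0 := hlog2.trans_le hl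
  have hx0 : 0 < x := by linarith
  have hsub : Set.Ioi x ⊆ Set.Ioi 2 := Set.Ioi_subset_Ioi hx
  have hLiint : IntervalIntegrable (fun t ↦ (1 - Real.log t) / t ^ 2 * Li t)
      MeasureTheory.volume 2 x := by
    refine ContinuousOn.intervalIntegrable ?_
    rw [Set.uIcc_of_le hx]
    refine ContinuousOn.mul (continuousOn_deriv_log_div_self.mono fun t ht ↦
      lt_of_lt_of_le (by norm_num) ht.1) fun t ht ↦
      (hasDerivAt_Li (lt_of_lt_of_le (by norm_num) ht.1)).continuousAt.continuousWithinAt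
  have hhint : IntervalIntegrable h MeasureTheory.volume 2 x :=
    (intervalIntegrable_iff_integrableOn_Ioc_of_le hx).mpr
      (hint.mono_set Set.Ioc_subset_Ioi_self)
  have e1 : ∫ t in (2 : ℝ)..x, (1 - Real.log t) / t ^ 2 * primeCount S t =
      δ * (∫ t in (2 : ℝ)..x, (1 - Real.log t) / t ^ 2 * Li t) + ∫ t in (2 : ℝ)..x, h t := by
    rw [← intervalIntegral.integral_const_mul,
      ← intervalIntegral.integral_add (hLiint.const_mul δ) hhint]
    refine intervalIntegral.integral_congr fun t _ ↦ ?_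
    simp only [hh, hE]
    ring
  have e2 : ∫ t in (2 : ℝ)..x, h t = (∫ t in Set.Ioi 2, h t) - ∫ t in Set.Ioi x, h t := by
    rw [intervalIntegral.integral_of_le hx, ← Set.Ioc_union_Ioi_eq_Ioi hx,
      MeasureTheory.setIntegral_union (Set.Ioc_disjoint_Ioi le_rfl) measurableSet_Ioi
        (hint.mono_set Set.Ioc_subset_Ioi_self) (hint.mono_set hsub)]
    ring
  have htail : |∫ t in Set.Ioi x, h t| ≤ K / ρ / Real.log x ^ ρ := by
    rw [← Real.norm_eq_abs]
    calc ‖∫ t in Set.Ioi x, h t‖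
        ≤ ∫ t in Set.Ioi x, K * (t⁻¹ * Real.log t ^ (-(1 + ρ))) := by
          refine MeasureTheory.norm_integral_le_of_norm_le
            ((integrableOn_inv_mul_log_rpow hρ (by linarith)).const_mul K) ?_
          filter_upwards [MeasureTheory.ae_restrict_mem measurableSet_Ioi] with t ht
          exact hbound t (hx.trans (le_of_lt ht))
      _ = _ := by
          rw [MeasureTheory.integral_const_mul, integral_inv_mul_log_rpow hρ (by linarith),
            Real.rpow_neg hl0.le]
          ring
  have hE' : |Real.log x / x * E x| ≤ C / Real.log 2 / Real.log x ^ ρ := by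
    rw [abs_mul, abs_of_pos (by positivity : 0 < Real.log x / x)]
    calc _ ≤ Real.log x / x * (C * x / Real.log x ^ (2 + ρ)) := by
          gcongr
          exact hC x hx
      _ = C / Real.log x / Real.log x ^ ρ := by
          rw [hpow hx, Real.rpow_add hl0, Real.rpow_one]
          field_simp
      _ ≤ _ := by gcongr
  have hIBP := log_div_mul_Li_sub_integral hx
  rw [sum_log_div_eq S hx, e1, e2, add_div]
  have e3 : Real.log x / x * primeCount S x = Real.log x / x * E x +
      δ * (Real.log x / x * Li x) := by simp only [hE]; ring
  have e4 : Real.log x / x * primeCount S x -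
      (δ * (∫ t in (2 : ℝ)..x, (1 - Real.log t) / t ^ 2 * Li t) +
        ((∫ t in Set.Ioi 2, h t) - ∫ t in Set.Ioi x, h t)) - δ * Real.log x -
      (-δ * Real.log 2 - ∫ t in Set.Ioi 2, h t) =
      Real.log x / x * E x + ∫ t in Set.Ioi x, h t := by
    rw [e3]
    linear_combination δ * hIBP
  rw [e4]
  exact (abs_add_le _ _).trans (add_le_add hE' htail)

/-- Abel's theorem for Dirichlet series: if `∑ f n` converges, the `L`-series of `f` is right
continuous at `0`. -/
lemma tendsto_LSeries_nhdsGT_zero {f : ℕ → ℂ} {l : ℂ}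
    (hlim : Tendsto (fun n : ℕ ↦ ∑ k ∈ Finset.Icc 1 n, f k) atTop (nhds l))
    (hs : ∀ u : ℝ, 0 < u → LSeriesSummable f u) :
    Tendsto (fun u : ℝ ↦ LSeries f u) (nhdsWithin 0 (Set.Ioi 0)) (nhds l) := by
  set G : ℝ → ℂ := fun t ↦ ∑ k ∈ Finset.Icc 1 ⌊t⌋₊, f k with hG
  have hG0 (t : ℝ) (ht : t < 1) : G t = 0 := by
    simp [hG, Nat.floor_eq_zero.mpr ht]
  have hGlim : Tendsto G atTop (nhds l) := hlim.comp tendsto_nat_floor_atTop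
  have hGm : Measurable G := (Measurable.of_discrete
    (f := fun n : ℕ ↦ ∑ k ∈ Finset.Icc 1 n, f k)).comp Nat.measurable_floor
  obtain ⟨M, hM⟩ : ∃ M, ∀ t, ‖G t‖ ≤ M := by
    obtain ⟨M, hM⟩ := hlim.norm.bddAbove_range
    exact ⟨M, fun t ↦ hM ⟨⌊t⌋₊, rfl⟩⟩
  have hM0 : 0 ≤ M := (norm_nonneg _).trans (hM 0)
  have hrepr (u : ℝ) (hu : 0 < u) :
      LSeries f u = ∫ y in Set.Ioi (0 : ℝ), G (y ^ (-u⁻¹)) := by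
    rw [LSeries_eq_mul_integral f le_rfl (s := u) (by simpa using hu) (hs u hu)
      (by simpa using hlim.isBigO_one ℝ),
      ← MeasureTheory.integral_comp_rpow_Ioi _ (neg_ne_zero.mpr hu.ne'),
      ← MeasureTheory.integral_const_mul, ← MeasureTheory.integral_Ici_eq_integral_Ioi]
    have hrw : ∀ t ∈ Set.Ioi (0 : ℝ), (|-u| * t ^ (-u - 1)) • G ((t ^ (-u)) ^ (-u⁻¹)) =
        (u : ℂ) * (G t * (t : ℂ) ^ (-((u : ℂ) + 1))) := by
      intro t ht
      have ht' : 0 < t := ht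
      rw [← Real.rpow_mul ht'.le, neg_mul_neg, mul_inv_cancel₀ hu.ne', Real.rpow_one, abs_neg,
        abs_of_pos hu, Complex.real_smul]
      push_cast
      rw [Complex.ofReal_cpow ht'.le]
      push_cast
      rw [show -(u : ℂ) - 1 = -((u : ℂ) + 1) by ring]
      ring
    rw [MeasureTheory.setIntegral_congr_fun measurableSet_Ioi hrw]
    symm
    refine MeasureTheory.setIntegral_eq_of_subset_of_forall_sdiff_eq_zero measurableSet_Ioi
      (fun t ht ↦ lt_of_lt_of_le (one_pos : (0 : ℝ) < 1) ht) fun t ht ↦ ?_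
    rw [hG0 t (not_le.mp ht.2)]
    simp
  have hl : ∫ y in Set.Ioi (0 : ℝ), (Set.Ioc (0 : ℝ) 1).indicator (fun _ ↦ l) y = l := by
    rw [MeasureTheory.setIntegral_indicator measurableSet_Ioc,
      Set.inter_eq_right.mpr Set.Ioc_subset_Ioi_self]
    simp
  have hmain : Tendsto (fun u : ℝ ↦ ∫ y in Set.Ioi (0 : ℝ), G (y ^ (-u⁻¹)))
      (nhdsWithin 0 (Set.Ioi 0))
      (nhds (∫ y in Set.Ioi (0 : ℝ), (Set.Ioc (0 : ℝ) 1).indicator (fun _ ↦ l) y)) := by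
    refine MeasureTheory.tendsto_integral_filter_of_dominated_convergence
      ((Set.Ioc (0 : ℝ) 1).indicator fun _ ↦ M) ?_ ?_ ?_ ?_
    · refine Eventually.of_forall fun u ↦ Measurable.aestronglyMeasurable ?_
      exact hGm.comp (measurable_id.pow_const _)
    · filter_upwards [self_mem_nhdsWithin] with u hu
      filter_upwards [MeasureTheory.ae_restrict_mem measurableSet_Ioi] with y hy
      by_cases h1 : y ≤ 1
      · rw [Set.indicator_of_mem (show y ∈ Set.Ioc (0 : ℝ) 1 from ⟨hy, h1⟩)]
        exact hM _
      · rw [hG0 _ (Real.rpow_lt_one_of_one_lt_of_neg (not_le.mp h1)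
          (neg_lt_zero.mpr (inv_pos.mpr hu))), norm_zero]
        exact Set.indicator_nonneg (fun _ _ ↦ hM0) _
    · rw [MeasureTheory.integrable_indicator_iff measurableSet_Ioc]
      refine MeasureTheory.integrableOn_const ?_
      exact ((MeasureTheory.Measure.restrict_apply_le _ _).trans_lt (by simp)).ne
    · have hne : ∀ᵐ y : ℝ ∂(MeasureTheory.volume.restrict (Set.Ioi (0 : ℝ))), y ≠ 1 :=
        MeasureTheory.ae_restrict_of_ae (by simp [MeasureTheory.ae_iff])
      filter_upwards [MeasureTheory.ae_restrict_mem measurableSet_Ioi, hne] with y hy hy1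
      have hy0 : 0 < y := hy
      rcases lt_or_gt_of_ne hy1 with h | h
      · rw [Set.indicator_of_mem (show y ∈ Set.Ioc (0 : ℝ) 1 from ⟨hy, h.le⟩)]
        refine hGlim.comp ?_
        exact (tendsto_rpow_atBot_of_base_lt_one y hy0 h).comp
          (tendsto_neg_atTop_atBot.comp tendsto_inv_nhdsGT_zero)
      · rw [Set.indicator_of_notMem fun h' ↦ absurd h'.2 (not_le.mpr h)]
        refine tendsto_const_nhds.congr' ?_
        filter_upwards [self_mem_nhdsWithin] with u hu
        exact (hG0 _ (Real.rpow_lt_one_of_one_lt_of_neg h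
          (neg_lt_zero.mpr (inv_pos.mpr hu)))).symm
  rw [hl] at hmain
  refine hmain.congr' ?_
  filter_upwards [self_mem_nhdsWithin] with u hu
  exact (hrepr u hu).symm

lemma IsVonMangoldtOf.abs_le_vonMangoldt_add {S : Set ℕ} {ΛS : ℕ → ℝ}
    (hΛ : IsVonMangoldtOf S ΛS) (h1 : 1 ∈ S) (n : ℕ) :
    |ΛS n| ≤ ArithmeticFunction.vonMangoldt n + |nonprimePart ΛS n| := by
  by_cases hn : n.Prime
  · rw [ArithmeticFunction.vonMangoldt_apply_prime hn, hΛ.apply_prime h1 hn]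
    have := Real.log_natCast_nonneg n
    simp only [nonprimePart, hn, if_true, chiS]
    split_ifs <;> simp [abs_of_nonneg, this]
  · simp [nonprimePart, hn, ArithmeticFunction.vonMangoldt_nonneg]

lemma IsVonMangoldtOf.lseriesSummable {S : Set ℕ} {ΛS : ℕ → ℝ}
    (hΛ : IsVonMangoldtOf S ΛS) (h1 : 1 ∈ S) {s : ℝ} (hs : 1 < s) :
    LSeriesSummable (fun n ↦ (ΛS n : ℂ)) s := by
  have hv := (ArithmeticFunction.LSeriesSummable_vonMangoldt (s := s) (by simpa using hs)).norm
  refine Summable.of_norm_bounded (hv.add (hΛ.summable_nonprimePart h1)) fun n ↦ ?_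
  rcases n.eq_zero_or_pos with rfl | hn
  · simp
  · have hn0 : (0 : ℝ) < n := by exact_mod_cast hn
    have hn1 : (1 : ℝ) ≤ n := by exact_mod_cast hn
    simp only [LSeries.norm_term_eq, hn.ne', if_false, Complex.ofReal_re, Complex.norm_real,
      Real.norm_eq_abs]
    calc |ΛS n| / (n : ℝ) ^ s
        ≤ (ArithmeticFunction.vonMangoldt n + |nonprimePart ΛS n|) / (n : ℝ) ^ s := by
          gcongr
          exact hΛ.abs_le_vonMangoldt_add h1 n
      _ = |ArithmeticFunction.vonMangoldt n| / (n : ℝ) ^ s +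
          |nonprimePart ΛS n| * (n : ℝ) ^ (-s) := by
          rw [add_div, abs_of_nonneg ArithmeticFunction.vonMangoldt_nonneg,
            Real.rpow_neg hn0.le, ← div_eq_mul_inv (|nonprimePart ΛS n|)]
      _ ≤ _ := by
          gcongr
          linarith

lemma abscissaOfAbsConv_chiS_lt (S : Set ℕ) {s : ℝ} (hs : 1 < s) :
    LSeries.abscissaOfAbsConv (fun n ↦ (chiS S n : ℂ)) < (s : ℂ).re := by
  refine lt_of_le_of_lt (LSeries.abscissaOfAbsConv_le_one_of_isBigO_one ?_)
    (by simp only [Complex.ofReal_re]; exact_mod_cast hs)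
  refine Asymptotics.isBigO_of_le _ fun n ↦ ?_
  simp only [chiS]
  split_ifs <;> simp

lemma term_chiS (S : Set ℕ) {s : ℝ} (hs : 1 < s) (n : ℕ) :
    LSeries.term (fun n ↦ (chiS S n : ℂ)) s n =
      ((if n ∈ S then (n : ℝ) ^ (-s) else 0 : ℝ) : ℂ) := by
  rcases n.eq_zero_or_pos with rfl | hn
  · simp [Real.zero_rpow (by linarith : -s ≠ 0)]
  · rw [LSeries.term_of_ne_zero hn.ne']
    simp only [chiS]
    split_ifs
    · rw [Real.rpow_neg (Nat.cast_nonneg n), Complex.ofReal_inv,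
        Complex.ofReal_cpow (Nat.cast_nonneg n)]
      simp
    · simp

lemma ofReal_LSeries' (S : Set ℕ) {s : ℝ} (hs : 1 < s) :
    (LSeries' S s : ℂ) = LSeries (fun n ↦ (chiS S n : ℂ)) s := by
  rw [LSeries', LSeries, Complex.ofReal_tsum]
  exact tsum_congr fun n ↦ (term_chiS S hs n).symm

lemma LSeries'_pos {S : Set ℕ} (h1 : 1 ∈ S) {s : ℝ} (hs : 1 < s) : 0 < LSeries' S s := by
  have hsum : Summable fun n : ℕ ↦ if n ∈ S then (n : ℝ) ^ (-s) else 0 := by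
    have := LSeriesSummable_of_abscissaOfAbsConv_lt_re (abscissaOfAbsConv_chiS_lt S hs)
    rw [LSeriesSummable, funext (term_chiS S hs)] at this
    exact_mod_cast this
  refine hsum.tsum_pos (fun n ↦ ?_) 1 (by simp [h1])
  split_ifs <;> positivity

lemma logMul_chiS_eq_convolution {S : Set ℕ} {ΛS : ℕ → ℝ} (hΛ : IsVonMangoldtOf S ΛS) {n : ℕ}
    (hn : n ≠ 0) :
    LSeries.logMul (fun n ↦ (chiS S n : ℂ)) n =
      LSeries.convolution (fun n ↦ (chiS S n : ℂ)) (fun n ↦ (ΛS n : ℂ)) n := by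
  rw [LSeries.convolution_def, LSeries.logMul]
  simp only
  rw [Nat.sum_divisorsAntidiagonal' (f := fun i j ↦ (chiS S i : ℂ) * (ΛS j : ℂ)),
    ← Complex.natCast_log, mul_comm]
  exact_mod_cast hΛ.2 n (Nat.one_le_iff_ne_zero.mpr hn)

lemma IsVonMangoldtOf.deriv_LSeries'_div {S : Set ℕ} {ΛS : ℕ → ℝ} (hΛ : IsVonMangoldtOf S ΛS)
    (h1 : 1 ∈ S) {s : ℝ} (hs : 1 < s) :
    deriv (LSeries' S) s / LSeries' S s = -(LSeries (fun n ↦ (ΛS n : ℂ)) s).re := by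
  have habs := abscissaOfAbsConv_chiS_lt S hs
  have hd := (LSeries_hasDerivAt habs).real_of_complex
  have heq : LSeries' S =ᶠ[nhds s] fun x : ℝ ↦ (LSeries (fun n ↦ (chiS S n : ℂ)) x).re := by
    filter_upwards [Ioi_mem_nhds hs] with x hx
    rw [← ofReal_LSeries' S hx, Complex.ofReal_re]
  rw [(hd.congr_of_eventuallyEq heq).deriv,
    LSeries_congr (fun hn ↦ logMul_chiS_eq_convolution hΛ hn) s,
    LSeries_convolution' (LSeriesSummable_of_abscissaOfAbsConv_lt_re habs)
      (hΛ.lseriesSummable h1 hs), ← ofReal_LSeries' S hs, Complex.neg_re, Complex.re_ofReal_mul]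
  have := (LSeries'_pos h1 hs).ne'
  field_simp

/-- The Euler–Kronecker constant is minus the constant term of `∑_{n ≤ N} Λ_S(n) / n`. -/
lemma IsVonMangoldtOf.tendsto_deriv_div_add {S : Set ℕ} {ΛS : ℕ → ℝ} {δ c : ℝ}
    (hΛ : IsVonMangoldtOf S ΛS) (h1 : 1 ∈ S)
    (hlim : Tendsto (fun n : ℕ ↦ ∑ k ∈ Finset.Icc 1 n, ΛS k / k - δ * Real.log n) atTop
      (nhds c)) :
    IsEulerKronecker S δ (-c) := by
  have hH : Tendsto (fun n : ℕ ↦ ∑ k ∈ Finset.Icc 1 n, (ΛS k - δ) / k) atTop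
      (nhds (c - δ * Real.eulerMascheroniConstant)) := by
    refine (hlim.sub (Real.tendsto_harmonic_sub_log.const_mul δ)).congr fun n ↦ ?_
    rw [harmonic_eq_sum_Icc]
    simp only [sub_div, Finset.sum_sub_distrib]
    push_cast
    have h : ∑ k ∈ Finset.Icc 1 n, δ / (k : ℝ) = δ * ∑ k ∈ Finset.Icc 1 n, (k : ℝ)⁻¹ := by
      simp only [div_eq_mul_inv, Finset.mul_sum]
    rw [h]
    ring
  set f : ℕ → ℂ := fun n ↦ (((ΛS n - δ) / n : ℝ) : ℂ) with hf
  have hterm (u : ℝ) : LSeries.term f u =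
      LSeries.term ((fun n ↦ (ΛS n : ℂ)) - (δ : ℂ) • (1 : ℕ → ℂ)) ((1 + u : ℝ) : ℂ) := by
    ext n
    rcases n.eq_zero_or_pos with rfl | hn
    · simp
    · have hn' : (n : ℂ) ≠ 0 := by exact_mod_cast hn.ne'
      rw [LSeries.term_of_ne_zero hn.ne', LSeries.term_of_ne_zero hn.ne']
      push_cast
      rw [Complex.cpow_add _ _ hn', Complex.cpow_one]
      simp [hf, div_div]
  have hsub (u : ℝ) (hu : 0 < u) := (hΛ.lseriesSummable h1 (by linarith : 1 < 1 + u))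
  have hone (u : ℝ) (hu : 0 < u) : LSeriesSummable ((δ : ℂ) • (1 : ℕ → ℂ)) ((1 + u : ℝ) : ℂ) :=
    (LSeriesSummable_one_iff.mpr (by simpa using hu)).smul _
  have hA := tendsto_LSeries_nhdsGT_zero (f := f)
    (l := ((c - δ * Real.eulerMascheroniConstant : ℝ) : ℂ))
    (by simp only [hf, ← Complex.ofReal_sum]; exact (Complex.continuous_ofReal.tendsto _).comp hH)
    (fun u hu ↦ by
      rw [LSeriesSummable, hterm]
      exact (hsub u hu).sub (hone u hu))
  have hshift : Tendsto (fun s : ℝ ↦ s - 1) (nhdsWithin 1 (Set.Ioi 1))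
      (nhdsWithin 0 (Set.Ioi 0)) := by
    refine tendsto_nhdsWithin_iff.mpr ⟨?_, ?_⟩
    · have : Tendsto (fun s : ℝ ↦ s - 1) (nhds 1) (nhds (1 - 1)) := tendsto_id.sub_const 1
      rw [sub_self] at this
      exact this.mono_left nhdsWithin_le_nhds
    · filter_upwards [self_mem_nhdsWithin] with s hs
      exact sub_pos.mpr (Set.mem_Ioi.mp hs)
  have hζ : Tendsto (fun s : ℝ ↦ riemannZeta s - 1 / ((s : ℂ) - 1)) (nhdsWithin 1 (Set.Ioi 1))
      (nhds Real.eulerMascheroniConstant) := by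
    refine tendsto_riemannZeta_sub_one_div.comp ?_
    refine tendsto_nhdsWithin_iff.mpr ⟨?_, ?_⟩
    · exact ((Complex.continuous_ofReal.tendsto 1).mono_left nhdsWithin_le_nhds).trans (by simp)
    · filter_upwards [self_mem_nhdsWithin] with s hs
      simpa using ne_of_gt hs
  have hfin := (hA.comp hshift).add (hζ.const_mul (δ : ℂ))
  have hre := ((Complex.continuous_re.tendsto _).comp hfin).neg
  rw [IsEulerKronecker]
  convert! hre.congr' ?_ using 2
  · simp
  · filter_upwards [self_mem_nhdsWithin] with s hs
    have hs1 : (1 : ℝ) < s := hs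
    have hpos : 0 < s - 1 := sub_pos.mpr hs1
    have e : LSeries f ((s - 1 : ℝ) : ℂ) =
        LSeries (fun n ↦ (ΛS n : ℂ)) s - δ * riemannZeta s := by
      have h := hone _ hpos
      have h' := hsub _ hpos
      rw [LSeries, hterm, ← LSeries]
      rw [add_sub_cancel] at h h' ⊢
      rw [LSeries_sub h' h, LSeries_smul, LSeries_one_eq_riemannZeta (by simpa using hs1)]
    have hdiv : (1 / ((s : ℂ) - 1)) = ((1 / (s - 1) : ℝ) : ℂ) := by push_cast; rfl
    simp only [Function.comp_apply]
    rw [e, hΛ.deriv_LSeries'_div h1 hs1, hdiv]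
    simp only [Complex.add_re, Complex.sub_re, Complex.re_ofReal_mul, Complex.ofReal_re]
    ring

lemma IsVonMangoldtOf.exists_sum_div_bound {S : Set ℕ} {δ ρ : ℝ} {ΛS : ℕ → ℝ}
    (hΛ : IsVonMangoldtOf S ΛS) (h1 : 1 ∈ S) (hρ : 0 < ρ) (hB : ConditionB S δ ρ) :
    ∃ c C : ℝ, ∀ x : ℝ, 2 ≤ x →
      |∑ n ∈ Finset.Icc 1 ⌊x⌋₊, ΛS n / n - δ * Real.log x - c| ≤ C / Real.log x ^ ρ := by
  obtain ⟨c, C, hC⟩ := hB.exists_sum_log_div_bound hρ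
  have hg := hΛ.summable_nonprimePart h1
  set D := ∑' n : ℕ, nonprimePart ΛS n / n
  set K := ∑' n : ℕ, |nonprimePart ΛS n| * (n : ℝ) ^ (-(9 / 10) : ℝ)
  have hK : 0 ≤ K := tsum_nonneg fun n ↦ by positivity
  refine ⟨c + D, C + K * (ρ / (1 / 10)) ^ ρ, fun x hx ↦ ?_⟩
  have hsplit : ∑ n ∈ Finset.Icc 1 ⌊x⌋₊, ΛS n / n =
      ∑ k ∈ Finset.Icc 1 ⌊x⌋₊, (if k.Prime then chiS S k * Real.log k else 0) / k +
        ∑ n ∈ Finset.Icc 1 ⌊x⌋₊, nonprimePart ΛS n / n := by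
    rw [← Finset.sum_add_distrib]
    refine Finset.sum_congr rfl fun n _ ↦ ?_
    by_cases hn : n.Prime
    · simp [nonprimePart, hn, hΛ.apply_prime h1 hn]
    · simp [nonprimePart, hn]
  have hD := (abs_sum_div_sub_tsum_le hg (by linarith : 1 ≤ x)).trans
    (mul_le_mul_of_nonneg_left
      (rpow_neg_le_div_log_rpow hρ (by norm_num : (0 : ℝ) < 1 / 10) (by linarith : 1 < x)) hK)
  rw [hsplit, add_div, mul_div_assoc]
  refine le_trans (le_of_eq_of_le ?_ (abs_add_le _ _)) (add_le_add (hC x hx) hD)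
  congr 1
  ring

/-- If the multiplicative set `S` satisfies Condition B with density `δ` and exponent
`ρ`, then `∑_{n ≤ x} Λ_S(n)/n = δ log x - γ_S + O(1/(log x)^ρ)`. -/
theorem sum_vonMangoldt_div (S : Set ℕ) (δ ρ γS : ℝ) (ΛS : ℕ → ℝ)
    (hδ : 0 < δ) (hρ : 0 < ρ) (hS : IsMultiplicativeSet S) (hB : ConditionB S δ ρ)
    (hEK : IsEulerKronecker S δ γS) (hΛ : IsVonMangoldtOf S ΛS) :
    ∃ C : ℝ, ∀ x : ℝ, 2 ≤ x →
      |(∑ n ∈ Finset.Icc 1 ⌊x⌋₊, ΛS n / (n : ℝ)) - δ * Real.log x + γS| ≤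
        C / Real.log x ^ ρ := by
  have h1 := hS.1
  obtain ⟨c, C, hC⟩ := hΛ.exists_sum_div_bound h1 hρ hB
  have hdecay : Tendsto (fun n : ℕ ↦ C / Real.log n ^ ρ) atTop (nhds 0) :=
    tendsto_const_nhds.div_atTop <| (tendsto_rpow_atTop hρ).comp <|
      Real.tendsto_log_atTop.comp tendsto_natCast_atTop_atTop
  have hlim : Tendsto (fun n : ℕ ↦ ∑ k ∈ Finset.Icc 1 n, ΛS k / k - δ * Real.log n) atTop
      (nhds c) := by
    rw [tendsto_iff_norm_sub_tendsto_zero]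
    refine squeeze_zero' (Eventually.of_forall fun n ↦ norm_nonneg _) ?_ hdecay
    filter_upwards [eventually_ge_atTop 2] with n hn
    simpa using hC n (by exact_mod_cast hn)
  obtain rfl : γS = -c := tendsto_nhds_unique hEK (hΛ.tendsto_deriv_div_add h1 hlim)
  exact ⟨C, fun x hx ↦ by simpa only [← sub_eq_add_neg] using hC x hx⟩
end

section
/- Let S_B be the set of positive integers expressible as a sum of two integer squares, and let γ_{S_B} = lim_{s→1⁺}(L_{S_B}'(s)/L_{S_B}(s) + (1/2)/(s−1)) be its Euler–Kronecker constant. Then γ_{S_B} exists and γ_{S_B} = γ/2 + (1/2)·(L'/L)(1, χ_{−4}) − (log 2)/2 − Σ_{p ≡ 3 (mod 4)} (log p)/(p² − 1), where the last sum runs over all primes p ≡ 3 (mod 4) and converges absolutely. -/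
open Filter Real
open scoped Classical

/-- `S_{φ;q}`: the set of positive integers `n` with `q ∤ φ(n)`. -/
def SPhi (q : ℕ) : Set ℕ := {n : ℕ | 0 < n ∧ ¬ q ∣ Nat.totient n}

/-- `S'_{q;1}`: the set of positive integers all of whose prime factors are
`≡ 1 (mod q)`. -/
def SOne (q : ℕ) : Set ℕ :=
  {n : ℕ | 0 < n ∧ ∀ p : ℕ, p.Prime → p ∣ n → p % q = 1}

/-- `S_B`: the set of positive integers expressible as a sum of two integer squares. -/
def SB : Set ℕ := {n : ℕ | 0 < n ∧ ∃ a b : ℤ, (n : ℤ) = a ^ 2 + b ^ 2}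

/-- The nontrivial Dirichlet character mod 4. -/
noncomputable def chi4 (n : ℕ) : ℝ :=
  if n % 4 = 1 then 1 else if n % 4 = 3 then -1 else 0

open Topology

/-- The terms of the Dirichlet beta function `L(s, χ₋₄)` grouped in pairs. -/
noncomputable def betaTerm (k : ℕ) (s : ℂ) : ℂ :=
  ((4 * k + 1 : ℕ) : ℂ) ^ (-s) - ((4 * k + 3 : ℕ) : ℂ) ^ (-s)

/-- The Dirichlet beta function `L(s, χ₋₄)` for `0 < re s`, as an absolutely convergent series
of grouped terms. -/
noncomputable def dirichletBeta (s : ℂ) : ℂ := ∑' k : ℕ, betaTerm k s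

/-- A region around `1` on which the grouped beta series is dominated by a summable series. -/
def betaRegion : Set ℂ := {s | 1 / 2 < s.re} ∩ Metric.ball 0 3

lemma isOpen_betaRegion : IsOpen betaRegion :=
  (isOpen_lt continuous_const Complex.continuous_re).inter Metric.isOpen_ball

lemma one_mem_betaRegion : (1 : ℂ) ∈ betaRegion := by
  constructor <;> norm_num

lemma norm_betaTerm_le (k : ℕ) {s : ℂ} (hs : s ∈ betaRegion) :
    ‖betaTerm k s‖ ≤ 6 * ((4 * k + 1 : ℕ) : ℝ) ^ (-(3 / 2) : ℝ) := by
  have hre : 1 / 2 < s.re := hs.1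
  have hn : ‖s‖ < 3 := by simpa using hs.2
  have hs0 : s ≠ 0 := by rintro rfl; norm_num at hre
  have h := Convex.norm_image_sub_le_of_norm_hasDerivWithin_le
    (f := fun x : ℝ => (x : ℂ) ^ (-s)) (f' := fun x : ℝ => -s * (x : ℂ) ^ (-s - 1))
    (s := Set.Icc ((4 * k + 1 : ℕ) : ℝ) ((4 * k + 3 : ℕ) : ℝ))
    (C := 3 * ((4 * k + 1 : ℕ) : ℝ) ^ (-(3 / 2) : ℝ))
    (x := ((4 * k + 1 : ℕ) : ℝ)) (y := ((4 * k + 3 : ℕ) : ℝ)) ?_ ?_ (convex_Icc _ _)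
    (by simp) (by simp)
  · rw [betaTerm, norm_sub_rev]
    refine le_trans (by simpa only [Complex.ofReal_natCast] using h) (le_of_eq ?_)
    rw [show ((4 * k + 3 : ℕ) : ℝ) - ((4 * k + 1 : ℕ) : ℝ) = 2 by push_cast; ring]
    norm_num
    ring
  · intro x hx
    have hx0 : 0 < x := lt_of_lt_of_le (by positivity) hx.1
    exact (hasDerivAt_ofReal_cpow_const hx0.ne' (neg_ne_zero.2 hs0)).hasDerivWithinAt
  · intro x hx
    have hx1 : 1 ≤ x := le_trans (by simp) hx.1
    rw [norm_mul, norm_neg, Complex.norm_cpow_eq_rpow_re_of_pos (by linarith)]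
    gcongr
    calc x ^ (-s - 1).re ≤ x ^ (-(3 / 2) : ℝ) :=
          Real.rpow_le_rpow_of_exponent_le hx1 (by
            simp only [Complex.sub_re, Complex.neg_re, Complex.one_re]; linarith)
      _ ≤ _ := Real.rpow_le_rpow_of_nonpos (by positivity) hx.1 (by norm_num)

lemma summable_betaBound : Summable fun k : ℕ => 6 * ((4 * k + 1 : ℕ) : ℝ) ^ (-(3 / 2) : ℝ) :=
  ((Real.summable_nat_rpow.2 (by norm_num : (-(3 / 2) : ℝ) < -1)).comp_injective
    (i := fun k : ℕ => 4 * k + 1) (fun a b h => by simpa using h)).mul_left _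

lemma hasDerivAt_natCast_cpow_neg {n : ℕ} (hn : n ≠ 0) (s : ℂ) :
    HasDerivAt (fun s : ℂ => (n : ℂ) ^ (-s)) (-(Real.log n * (n : ℂ) ^ (-s))) s := by
  have h := (hasDerivAt_id s).neg.const_cpow (c := (n : ℂ)) (Or.inl (by exact_mod_cast hn))
  convert! h using 1
  rw [← Complex.natCast_log]
  simp only [Pi.neg_apply, id]
  ring

lemma hasDerivAt_betaTerm (k : ℕ) (s : ℂ) :
    HasDerivAt (betaTerm k) (-(Real.log (4 * k + 1 : ℕ) * ((4 * k + 1 : ℕ) : ℂ) ^ (-s)) -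
      -(Real.log (4 * k + 3 : ℕ) * ((4 * k + 3 : ℕ) : ℂ) ^ (-s))) s :=
  (hasDerivAt_natCast_cpow_neg (by omega) s).sub (hasDerivAt_natCast_cpow_neg (by omega) s)

lemma differentiableOn_dirichletBeta : DifferentiableOn ℂ dirichletBeta betaRegion :=
  Complex.differentiableOn_tsum_of_summable_norm summable_betaBound
    (fun k s _ => (hasDerivAt_betaTerm k s).differentiableAt.differentiableWithinAt)
    isOpen_betaRegion fun k _ hs => norm_betaTerm_le k hs

lemma hasSum_dirichletBeta_one : HasSum (fun k => betaTerm k 1) (dirichletBeta 1) :=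
  (Summable.of_norm_bounded summable_betaBound
    fun k => norm_betaTerm_le k one_mem_betaRegion).hasSum

lemma hasSum_deriv_dirichletBeta_one :
    HasSum (fun k => deriv (betaTerm k) 1) (deriv dirichletBeta 1) :=
  Complex.hasSum_deriv_of_summable_norm summable_betaBound
    (fun k s _ => (hasDerivAt_betaTerm k s).differentiableAt.differentiableWithinAt)
    isOpen_betaRegion (fun k _ hs => norm_betaTerm_le k hs) one_mem_betaRegion

/-- If a sequence tends to zero and its partial sums along multiples of `m` converge, then all
partial sums converge. -/
lemma tendsto_sum_range_of_tendsto_sum_range_mul {f : ℕ → ℝ} {a : ℝ} {m : ℕ} (hm : 0 < m)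
    (hf : Tendsto f atTop (𝓝 0))
    (h : Tendsto (fun K => ∑ n ∈ Finset.range (m * K), f n) atTop (𝓝 a)) :
    Tendsto (fun N => ∑ n ∈ Finset.range N, f n) atTop (𝓝 a) := by
  have hdiv : Tendsto (fun N => N / m) atTop atTop := Nat.tendsto_div_const_atTop hm.ne'
  have hmul : Tendsto (fun N => m * (N / m)) atTop atTop :=
    (tendsto_id.const_mul_atTop' hm).comp hdiv
  have h1 : Tendsto (fun N => ∑ i ∈ Finset.range (N % m), f (m * (N / m) + i)) atTop (𝓝 0) := by
    refine squeeze_zero_norm (a := fun N => ∑ i ∈ Finset.range m, ‖f (m * (N / m) + i)‖)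
      (fun N => (norm_sum_le _ _).trans (Finset.sum_le_sum_of_subset_of_nonneg
        (Finset.range_subset_range.2 (Nat.mod_lt _ hm).le) fun _ _ _ => norm_nonneg _)) ?_
    rw [← Finset.sum_const_zero (ι := ℕ) (s := Finset.range m)]
    refine tendsto_finsetSum _ fun i _ => ?_
    have := (hf.comp (tendsto_atTop_mono (fun _ => Nat.le_add_right _ i) hmul)).norm
    simpa using this
  have h2 := (h.comp hdiv).add h1
  rw [add_zero] at h2
  refine h2.congr fun N => ?_
  rw [Function.comp_apply, ← Finset.sum_range_add, Nat.div_add_mod]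

lemma sum_range_four_mul (f : ℕ → ℝ) (K : ℕ) :
    ∑ n ∈ Finset.range (4 * K), f n =
      ∑ k ∈ Finset.range K, (f (4 * k) + f (4 * k + 1) + f (4 * k + 2) + f (4 * k + 3)) := by
  induction K with
  | zero => simp
  | succ K ih =>
    rw [Finset.sum_range_succ, ← ih, mul_add, mul_one]
    simp only [Finset.sum_range_succ]
    ring

lemma chi4_four_mul (k : ℕ) : chi4 (4 * k) = 0 := by
  simp [chi4]

lemma chi4_four_mul_add_one (k : ℕ) : chi4 (4 * k + 1) = 1 := by
  simp [chi4, Nat.add_mod]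

lemma chi4_four_mul_add_two (k : ℕ) : chi4 (4 * k + 2) = 0 := by
  simp [chi4, Nat.add_mod]

lemma chi4_four_mul_add_three (k : ℕ) : chi4 (4 * k + 3) = -1 := by
  simp [chi4, Nat.add_mod]

lemma abs_chi4_le_one (n : ℕ) : |chi4 n| ≤ 1 := by
  unfold chi4
  split_ifs <;> simp

/-- A sum twisted by `χ₋₄` converges if its terms tend to zero and the grouped series does. -/
lemma tendsto_sum_chi4_mul {g : ℕ → ℝ} {a : ℝ} (hg : Tendsto g atTop (𝓝 0))
    (h : HasSum (fun k : ℕ => ((g (4 * k + 1) - g (4 * k + 3) : ℝ) : ℂ)) a) :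
    Tendsto (fun N => ∑ n ∈ Finset.range N, chi4 n * g n) atTop (𝓝 a) := by
  refine tendsto_sum_range_of_tendsto_sum_range_mul (m := 4) (by norm_num) ?_ ?_
  · refine squeeze_zero_norm (a := fun n => ‖g n‖) (fun n => ?_) (by simpa using hg.norm)
    rw [norm_mul]
    exact mul_le_of_le_one_left (norm_nonneg _) (abs_chi4_le_one n)
  · refine (Complex.hasSum_ofReal.1 h).tendsto_sum_nat.congr fun K => ?_
    rw [sum_range_four_mul]
    refine Finset.sum_congr rfl fun k _ => ?_
    rw [chi4_four_mul, chi4_four_mul_add_one, chi4_four_mul_add_two, chi4_four_mul_add_three]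
    ring

lemma betaTerm_one (k : ℕ) :
    betaTerm k 1 = (((4 * k + 1 : ℕ) : ℝ)⁻¹ - ((4 * k + 3 : ℕ) : ℝ)⁻¹ : ℝ) := by
  simp only [betaTerm, Complex.cpow_neg_one]
  push_cast
  rfl

lemma deriv_betaTerm_one (k : ℕ) :
    deriv (betaTerm k) 1 = (-(Real.log (4 * k + 1 : ℕ) / (4 * k + 1 : ℕ)) -
      -(Real.log (4 * k + 3 : ℕ) / (4 * k + 3 : ℕ)) : ℝ) := by
  rw [(hasDerivAt_betaTerm k 1).deriv]
  simp only [Complex.cpow_neg_one]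
  push_cast [div_eq_mul_inv]
  rfl

lemma ofReal_re_eq_of_hasSum {f : ℕ → ℝ} {z : ℂ} (h : HasSum (fun k => (f k : ℂ)) z) :
    (z.re : ℂ) = z :=
  (Complex.hasSum_ofReal.2 (by simpa using Complex.hasSum_re h)).unique h

lemma ofReal_re_dirichletBeta_one : ((dirichletBeta 1).re : ℂ) = dirichletBeta 1 :=
  ofReal_re_eq_of_hasSum (by simpa only [betaTerm_one] using hasSum_dirichletBeta_one)

lemma ofReal_re_deriv_dirichletBeta_one :
    ((deriv dirichletBeta 1).re : ℂ) = deriv dirichletBeta 1 :=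
  ofReal_re_eq_of_hasSum (by simpa only [deriv_betaTerm_one] using hasSum_deriv_dirichletBeta_one)

lemma tendsto_sum_chi4_div :
    Tendsto (fun N : ℕ => ∑ n ∈ Finset.range N, chi4 n / (n : ℝ)) atTop
      (𝓝 (dirichletBeta 1).re) := by
  refine tendsto_sum_chi4_mul (g := fun n => (n : ℝ)⁻¹) tendsto_inv_atTop_nhds_zero_nat ?_
  rw [ofReal_re_dirichletBeta_one]
  simpa only [betaTerm_one] using hasSum_dirichletBeta_one

lemma tendsto_neg_sum_chi4_mul_log_div :
    Tendsto (fun N : ℕ => -∑ n ∈ Finset.range N, chi4 n * Real.log n / (n : ℝ)) atTop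
      (𝓝 (deriv dirichletBeta 1).re) := by
  have h := tendsto_sum_chi4_mul (g := fun n => -(Real.log n / (n : ℝ)))
    (a := (deriv dirichletBeta 1).re) ?_ ?_
  · refine h.congr fun N => ?_
    rw [← Finset.sum_neg_distrib]
    exact Finset.sum_congr rfl fun n _ => by ring
  · have : Tendsto (fun x : ℝ => Real.log x / x) atTop (𝓝 0) := by
      simpa using Real.tendsto_pow_log_div_mul_add_atTop 1 0 1 one_ne_zero
    simpa using (this.comp tendsto_natCast_atTop_atTop).neg
  · rw [ofReal_re_deriv_dirichletBeta_one]
    simpa only [deriv_betaTerm_one] using hasSum_deriv_dirichletBeta_one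

/-- The nontrivial Dirichlet character mod 4, with complex values. -/
noncomputable def chi4Char : DirichletCharacter ℂ 4 :=
  ZMod.χ₄.ringHomComp (Int.castRingHom ℂ)

lemma chi4Char_natCast (n : ℕ) : chi4Char n = chi4 n := by
  have : chi4Char n = ((ZMod.χ₄ n : ℤ) : ℂ) := rfl
  rw [this, ZMod.χ₄_nat_eq_if_mod_four, chi4]
  split_ifs <;> first | omega | simp

lemma LSeries_chi4Char {s : ℂ} (hs : 1 < s.re) :
    LSeries (fun n => chi4Char n) s = dirichletBeta s := by
  have hsum : Summable (LSeries.term (fun n => chi4Char n) s) :=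
    DirichletCharacter.LSeriesSummable_of_one_lt_re chi4Char hs
  have hinj (j : ℕ) : Function.Injective fun m : ℕ => j + 4 * m := fun a b h => by
    simpa using h
  have h0 (m : ℕ) : LSeries.term (fun n => chi4Char n) s (4 * m) = 0 := by
    simp only [LSeries.term_def, chi4Char_natCast, chi4_four_mul]
    simp
  have h1 (m : ℕ) : LSeries.term (fun n => chi4Char n) s (1 + 4 * m) =
      ((4 * m + 1 : ℕ) : ℂ) ^ (-s) := by
    rw [add_comm, LSeries.term_of_ne_zero (by omega), chi4Char_natCast, chi4_four_mul_add_one,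
      Complex.cpow_neg, Complex.ofReal_one, one_div]
  have h2 (m : ℕ) : LSeries.term (fun n => chi4Char n) s (2 + 4 * m) = 0 := by
    rw [add_comm]
    simp only [LSeries.term_def, chi4Char_natCast, chi4_four_mul_add_two]
    simp
  have h3 (m : ℕ) : LSeries.term (fun n => chi4Char n) s (3 + 4 * m) =
      -((4 * m + 3 : ℕ) : ℂ) ^ (-s) := by
    rw [add_comm, LSeries.term_of_ne_zero (by omega), chi4Char_natCast, chi4_four_mul_add_three,
      Complex.cpow_neg, Complex.ofReal_neg, Complex.ofReal_one, neg_div, one_div]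
  have hs1 := hsum.comp_injective (hinj 1)
  have hs3 := hsum.comp_injective (hinj 3)
  simp only [Function.comp_def, h1, h3] at hs1 hs3
  rw [LSeries, Nat.sumByResidueClasses hsum 4]
  change ∑ j : Fin 4, ∑' m, LSeries.term (fun n => chi4Char n) s (j.val + 4 * m) = _
  rw [Fin.sum_univ_four]
  simp only [Fin.coe_ofNat_eq_mod, Nat.zero_mod, Nat.one_mod, Nat.reduceMod, zero_add, h0, h1,
    h2, h3, tsum_zero, add_zero]
  rw [← hs1.tsum_add hs3, dirichletBeta]
  simp only [betaTerm, sub_eq_add_neg]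

lemma dirichletBeta_ne_zero {s : ℂ} (hs : 1 < s.re) : dirichletBeta s ≠ 0 := by
  rw [← LSeries_chi4Char hs]
  exact DirichletCharacter.LSeries_ne_zero_of_one_lt_re chi4Char hs

lemma dirichletBeta_one_ne_zero : dirichletBeta 1 ≠ 0 := by
  have h : HasSum (fun k : ℕ => (((4 * k + 1 : ℕ) : ℝ)⁻¹ - ((4 * k + 3 : ℕ) : ℝ)⁻¹ : ℝ))
      (dirichletBeta 1).re := by
    rw [← Complex.hasSum_ofReal, ofReal_re_dirichletBeta_one]
    simpa only [betaTerm_one] using hasSum_dirichletBeta_one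
  have hpos (k : ℕ) : 0 < (((4 * k + 1 : ℕ) : ℝ)⁻¹ - ((4 * k + 3 : ℕ) : ℝ)⁻¹ : ℝ) :=
    sub_pos.2 (inv_strictAnti₀ (by positivity) (by push_cast; linarith))
  have := h.summable.tsum_pos (fun k => (hpos k).le) 0 (hpos 0)
  rw [h.tsum_eq] at this
  intro h0
  simp [h0] at this

/-- The deviation from `1` of the factor at `p` of `∏ (1 - p ^ (-2s))`, the product running over
the primes `p ≡ 3 (mod 4)`. -/
noncomputable def inertTerm (p : Nat.Primes) (s : ℂ) : ℂ :=
  if (p : ℕ) % 4 = 3 then -(p : ℂ) ^ (-(2 * s)) else 0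

/-- The product `∏ (1 - p ^ (-2s))` over the primes `p ≡ 3 (mod 4)`. -/
noncomputable def inertProd (s : ℂ) : ℂ := ∏' p : Nat.Primes, (1 + inertTerm p s)

/-- A half-plane on which the product defining `inertProd` is dominated uniformly. -/
def inertRegion : Set ℂ := {s | 3 / 4 < s.re}

lemma isOpen_inertRegion : IsOpen inertRegion :=
  isOpen_lt continuous_const Complex.continuous_re

lemma norm_inertTerm_le (p : Nat.Primes) {s : ℂ} (hs : s ∈ inertRegion) :
    ‖inertTerm p s‖ ≤ (p : ℝ) ^ (-(3 / 2) : ℝ) := by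
  have hre : 3 / 4 < s.re := hs
  unfold inertTerm
  split_ifs
  · rw [norm_neg, Complex.norm_natCast_cpow_of_pos p.2.pos]
    refine Real.rpow_le_rpow_of_exponent_le (by exact_mod_cast p.2.one_le) ?_
    simp only [Complex.neg_re, Complex.mul_re, Complex.re_ofNat, Complex.im_ofNat]
    linarith
  · rw [norm_zero]; positivity

lemma summable_inertBound : Summable fun p : Nat.Primes => (p : ℝ) ^ (-(3 / 2) : ℝ) :=
  Nat.Primes.summable_rpow.2 (by norm_num)

lemma one_add_inertTerm_ne_zero (p : Nat.Primes) {s : ℂ} (hs : s ∈ inertRegion) :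
    1 + inertTerm p s ≠ 0 := by
  have h1 : ‖inertTerm p s‖ < 1 := (norm_inertTerm_le p hs).trans_lt
    (Real.rpow_lt_one_of_one_lt_of_neg (by exact_mod_cast p.2.one_lt) (by norm_num))
  intro h
  rw [← neg_eq_of_add_eq_zero_right h] at h1
  simp at h1

lemma hasDerivAt_inertTerm (p : Nat.Primes) (s : ℂ) :
    HasDerivAt (fun s => 1 + inertTerm p s)
      (if (p : ℕ) % 4 = 3 then 2 * (Real.log p * (p : ℂ) ^ (-(2 * s))) else 0) s := by
  unfold inertTerm
  split_ifs
  · have h := ((hasDerivAt_natCast_cpow_neg p.2.ne_zero (2 * s)).comp s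
      ((hasDerivAt_id s).const_mul 2)).neg.const_add 1
    convert! h using 1
    ring
  · simpa using hasDerivAt_const s (1 : ℂ)

lemma differentiableOn_one_add_inertTerm (p : Nat.Primes) :
    DifferentiableOn ℂ (fun s => 1 + inertTerm p s) inertRegion :=
  fun s _ => (hasDerivAt_inertTerm p s).differentiableAt.differentiableWithinAt

lemma hasProdLocallyUniformlyOn_inertProd :
    HasProdLocallyUniformlyOn (fun p s => 1 + inertTerm p s) inertProd inertRegion := by
  refine Summable.hasProdLocallyUniformlyOn_one_add isOpen_inertRegion summable_inertBound
    (Eventually.of_forall fun p s hs => norm_inertTerm_le p hs) fun p => ?_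
  exact ((differentiableOn_one_add_inertTerm p).continuousOn.sub
    (continuousOn_const (c := (1 : ℂ)))).congr fun s _ => by simp

lemma differentiableOn_inertProd : DifferentiableOn ℂ inertProd inertRegion :=
  (hasProdLocallyUniformlyOn_iff_tendstoLocallyUniformlyOn.1
    hasProdLocallyUniformlyOn_inertProd).differentiableOn
    (Eventually.of_forall fun _ => DifferentiableOn.fun_finsetProd
      fun p _ => differentiableOn_one_add_inertTerm p) isOpen_inertRegion

lemma hasProd_inertProd {s : ℂ} (hs : s ∈ inertRegion) :
    HasProd (fun p => 1 + inertTerm p s) (inertProd s) :=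
  (multipliable_one_add_of_summable (summable_inertBound.of_nonneg_of_le
    (fun _ => norm_nonneg _) fun p => norm_inertTerm_le p hs)).hasProd

lemma inertProd_ne_zero {s : ℂ} (hs : s ∈ inertRegion) : inertProd s ≠ 0 :=
  tprod_one_add_ne_zero_of_summable (fun p => one_add_inertTerm_ne_zero p hs)
    (summable_inertBound.of_nonneg_of_le (fun _ => norm_nonneg _) fun p => norm_inertTerm_le p hs)

lemma one_mem_inertRegion : (1 : ℂ) ∈ inertRegion := by
  norm_num [inertRegion]

lemma summable_log_div_sq_sub_one : Summable fun n : ℕ => Real.log n / ((n : ℝ) ^ 2 - 1) := by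
  refine ((Real.summable_nat_rpow.2 (by norm_num : (-(3 / 2) : ℝ) < -1)).mul_left
    4).of_norm_bounded fun n => ?_
  rcases lt_or_ge n 2 with hn | hn
  · interval_cases n <;> simp
  have hn' : (2 : ℝ) ≤ n := by exact_mod_cast hn
  have hlog : Real.log n ≤ (n : ℝ) ^ (1 / 2 : ℝ) / (1 / 2) :=
    Real.log_le_rpow_div (by linarith) (by norm_num)
  have hden : (n : ℝ) ^ 2 / 2 ≤ (n : ℝ) ^ 2 - 1 := by nlinarith
  have hlog0 : 0 ≤ Real.log n := Real.log_natCast_nonneg n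
  rw [Real.norm_of_nonneg (div_nonneg hlog0 (by nlinarith))]
  calc Real.log n / ((n : ℝ) ^ 2 - 1)
      ≤ ((n : ℝ) ^ (1 / 2 : ℝ) / (1 / 2)) / ((n : ℝ) ^ 2 / 2) := by gcongr
    _ = 4 * ((n : ℝ) ^ (1 / 2 : ℝ) / (n : ℝ) ^ (2 : ℝ)) := by
      rw [Real.rpow_two]; ring
    _ = 4 * (n : ℝ) ^ (-(3 / 2) : ℝ) := by
      rw [← Real.rpow_sub (by linarith)]; norm_num

lemma logDeriv_one_add_inertTerm_one (p : Nat.Primes) :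
    logDeriv (fun s => 1 + inertTerm p s) 1 =
      ((2 * (if (p : ℕ) % 4 = 3 then Real.log p / ((p : ℝ) ^ 2 - 1) else 0) : ℝ) : ℂ) := by
  rw [logDeriv_apply, (hasDerivAt_inertTerm p 1).deriv, inertTerm]
  split_ifs
  · have hp : (p : ℂ) ≠ 0 := by exact_mod_cast p.2.ne_zero
    have hp' : (p : ℂ) ^ 2 - 1 ≠ 0 := by
      have h1 : (1 : ℝ) < p := by exact_mod_cast p.2.one_lt
      have h2 : (p : ℝ) ^ 2 - 1 ≠ 0 := by nlinarith
      exact_mod_cast h2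
    rw [mul_one, Complex.cpow_neg, Complex.cpow_ofNat]
    have h3 : (1 : ℂ) + -((p : ℂ) ^ 2)⁻¹ = ((p : ℂ) ^ 2 - 1) / (p : ℂ) ^ 2 := by
      field_simp; ring
    rw [h3]
    push_cast
    field_simp
  · simp

lemma summable_inert_log :
    Summable fun p : Nat.Primes =>
      if (p : ℕ) % 4 = 3 then Real.log p / ((p : ℝ) ^ 2 - 1) else 0 := by
  refine (summable_log_div_sq_sub_one.subtype {p | p.Prime}).norm.of_norm_bounded fun p => ?_
  split_ifs
  · rfl
  · rw [norm_zero]; exact norm_nonneg _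

lemma tsum_inert_log :
    (∑' p : Nat.Primes, if (p : ℕ) % 4 = 3 then Real.log p / ((p : ℝ) ^ 2 - 1) else 0) =
      ∑' p : {p : ℕ // p.Prime ∧ p % 4 = 3}, Real.log p / ((p : ℝ) ^ 2 - 1) := by
  refine (tsum_subtype {p : ℕ | p.Prime}
    (fun p => if p % 4 = 3 then Real.log p / ((p : ℝ) ^ 2 - 1) else 0)).trans
    (Eq.trans ?_ (tsum_subtype {p : ℕ | p.Prime ∧ p % 4 = 3}
    (fun p => Real.log p / ((p : ℝ) ^ 2 - 1))).symm)
  refine tsum_congr fun p => ?_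
  by_cases h1 : p.Prime <;> by_cases h2 : p % 4 = 3 <;> simp [Set.indicator, h1, h2]

lemma logDeriv_inertProd_one :
    logDeriv inertProd 1 = ((2 * ∑' p : {p : ℕ // p.Prime ∧ p % 4 = 3},
      Real.log p / ((p : ℝ) ^ 2 - 1) : ℝ) : ℂ) := by
  have hs : Summable fun p : Nat.Primes => logDeriv (fun s => 1 + inertTerm p s) 1 := by
    simp only [logDeriv_one_add_inertTerm_one]
    exact Complex.summable_ofReal.2 (summable_inert_log.mul_left 2)
  refine (logDeriv_tprod_eq_tsum isOpen_inertRegion one_mem_inertRegion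
    (fun p => one_add_inertTerm_ne_zero p one_mem_inertRegion) differentiableOn_one_add_inertTerm
    hs ⟨_, hasProdLocallyUniformlyOn_inertProd⟩ (inertProd_ne_zero one_mem_inertRegion)).trans ?_
  simp only [logDeriv_one_add_inertTerm_one]
  rw [← Complex.ofReal_tsum, tsum_mul_left, tsum_inert_log]

lemma mem_SB_iff {n : ℕ} :
    n ∈ SB ↔ n ≠ 0 ∧ ∀ q : ℕ, q.Prime → q % 4 = 3 → Even (padicValNat q n) := by
  have h1 : (∃ a b : ℤ, (n : ℤ) = a ^ 2 + b ^ 2) ↔ ∃ x y : ℕ, n = x ^ 2 + y ^ 2 := by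
    constructor
    · rintro ⟨a, b, h⟩
      refine ⟨a.natAbs, b.natAbs, ?_⟩
      zify
      simpa using h
    · rintro ⟨x, y, h⟩
      exact ⟨x, y, by exact_mod_cast h⟩
  have h2 : n ∈ SB ↔ n ≠ 0 ∧ ∃ x y : ℕ, n = x ^ 2 + y ^ 2 := by
    rw [← h1, ← Nat.pos_iff_ne_zero]
    rfl
  rw [h2, Nat.eq_sq_add_sq_iff]
  refine and_congr_right fun hn => ⟨fun h q hq hq3 => ?_, fun h q hq => ?_⟩
  · by_cases hqn : q ∣ n
    · exact h q (Nat.mem_primeFactors.2 ⟨hq, hqn, hn⟩) hq3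
    · simp [padicValNat.eq_zero_of_not_dvd hqn]
  · exact h q (Nat.prime_of_mem_primeFactors hq)

lemma mul_mem_SB_iff {m n : ℕ} (h : m.Coprime n) : m * n ∈ SB ↔ m ∈ SB ∧ n ∈ SB := by
  rcases eq_or_ne m 0 with rfl | hm
  · simp [mem_SB_iff]
  rcases eq_or_ne n 0 with rfl | hn
  · simp [mem_SB_iff]
  simp only [mem_SB_iff, ne_eq, mul_eq_zero, hm, hn, or_self, not_false_eq_true, true_and]
  rw [← forall_and]
  refine forall_congr' fun q => ?_
  rw [← imp_and, ← imp_and]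
  refine imp_congr_right fun hq => imp_congr_right fun _ => ?_
  have := Fact.mk hq
  rw [padicValNat.mul hm hn]
  by_cases hqm : q ∣ m
  · have hqn : ¬ q ∣ n := fun hqn => hq.not_dvd_one (h ▸ Nat.dvd_gcd hqm hqn)
    simp [padicValNat.eq_zero_of_not_dvd hqn]
  · simp [padicValNat.eq_zero_of_not_dvd hqm]

lemma pow_mem_SB_iff {p : ℕ} (hp : p.Prime) (e : ℕ) : p ^ e ∈ SB ↔ (p % 4 = 3 → Even e) := by
  have := Fact.mk hp
  rw [mem_SB_iff]
  refine ⟨fun h h3 => by simpa using h.2 p hp h3, fun h => ⟨pow_ne_zero _ hp.ne_zero, ?_⟩⟩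
  intro q hq hq3
  rcases eq_or_ne q p with rfl | hqp
  · simpa using h hq3
  · have := Fact.mk hq
    rw [padicValNat.pow, padicValNat_primes hqp]
    simp

/-- The Dirichlet series of the sums of two squares, as a function of a complex variable. -/
noncomputable def LSeriesSB (s : ℂ) : ℂ := LSeries (fun n => if n ∈ SB then 1 else 0) s

lemma term_SB (s : ℂ) (n : ℕ) :
    LSeries.term (fun n => if n ∈ SB then 1 else 0) s n = if n ∈ SB then (n : ℂ) ^ (-s) else 0 := by
  rcases eq_or_ne n 0 with rfl | hn
  · simp [mem_SB_iff]
  · rw [LSeries.term_of_ne_zero hn, Complex.cpow_neg, ite_div, one_div, zero_div]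

lemma abscissaOfAbsConv_SB_le :
    LSeries.abscissaOfAbsConv (fun n => if n ∈ SB then 1 else 0) ≤ 1 :=
  LSeries.abscissaOfAbsConv_le_of_le_const ⟨1, fun n _ => by
    split_ifs <;> simp⟩

lemma LSeriesSummable_SB {s : ℂ} (hs : 1 < s.re) :
    LSeriesSummable (fun n => if n ∈ SB then 1 else 0) s :=
  LSeriesSummable_of_abscissaOfAbsConv_lt_re
    (abscissaOfAbsConv_SB_le.trans_lt (by exact_mod_cast hs))

lemma differentiableAt_LSeriesSB {s : ℂ} (hs : 1 < s.re) : DifferentiableAt ℂ LSeriesSB s :=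
  (LSeries_hasDerivAt
    (abscissaOfAbsConv_SB_le.trans_lt (by exact_mod_cast hs))).differentiableAt

lemma norm_prime_cpow_neg_lt_one {p : ℕ} (hp : p.Prime) {s : ℂ} (hs : 0 < s.re) :
    ‖(p : ℂ) ^ (-s)‖ < 1 := by
  rw [Complex.norm_natCast_cpow_of_pos hp.pos]
  exact Real.rpow_lt_one_of_one_lt_of_neg (by exact_mod_cast hp.one_lt) (by simpa using hs)

lemma tsum_ite_even_pow {x : ℂ} (hx : ‖x‖ < 1) :
    ∑' e : ℕ, (if Even e then x ^ e else 0) = (1 - x ^ 2)⁻¹ := by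
  refine HasSum.tsum_eq ?_
  rw [← add_zero (1 - x ^ 2)⁻¹]
  refine HasSum.even_add_odd ?_ ?_
  · simp only [even_two, Even.mul_right, if_true, pow_mul]
    refine hasSum_geometric_of_norm_lt_one ?_
    rw [norm_pow]
    exact pow_lt_one₀ (norm_nonneg _) hx two_ne_zero
  · simp

lemma hasProd_LSeriesSB {s : ℂ} (hs : 1 < s.re) :
    HasProd (fun p : Nat.Primes => if (p : ℕ) % 4 = 3 then (1 - ((p : ℂ) ^ (-s)) ^ 2)⁻¹
      else (1 - (p : ℂ) ^ (-s))⁻¹) (LSeriesSB s) := by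
  have hs0 : s ≠ 0 := Complex.ne_zero_of_one_lt_re hs
  have hcoe (n : ℕ) : (n : ℂ) ^ (-s) = riemannZetaSummandHom hs0 n := rfl
  have h := EulerProduct.eulerProduct_hasProd
    (f := LSeries.term (fun n => if n ∈ SB then 1 else 0) s) ?_ ?_ (LSeriesSummable_SB hs).norm ?_
  · rw [LSeriesSB, LSeries]
    convert! h using 2 with p
    have hx := norm_prime_cpow_neg_lt_one p.2 (zero_lt_one.trans hs)
    have ht (e : ℕ) : LSeries.term (fun n => if n ∈ SB then 1 else 0) s ((p : ℕ) ^ e) =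
        if (p : ℕ) % 4 = 3 → Even e then ((p : ℂ) ^ (-s)) ^ e else 0 := by
      rw [term_SB, hcoe, hcoe, map_pow]
      simp only [pow_mem_SB_iff p.2]
    simp only [ht]
    split_ifs with h3
    · simp only [h3, forall_const]
      exact (tsum_ite_even_pow hx).symm
    · simp only [h3, false_imp_iff, if_true]
      exact (tsum_geometric_of_norm_lt_one hx).symm
  · rw [term_SB, if_pos (by simp [mem_SB_iff])]
    simp
  · intro m n hmn
    simp only [term_SB, mul_mem_SB_iff hmn, hcoe, map_mul]
    split_ifs <;> simp_all
  · simp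

lemma LSeriesSB_sq_mul {s : ℂ} (hs : 1 < s.re) :
    LSeriesSB s ^ 2 * inertProd s * (1 - (2 : ℂ) ^ (-s)) = riemannZeta s * dirichletBeta s := by
  have hmem : s ∈ inertRegion := by
    change 3 / 4 < s.re
    linarith
  let two : Nat.Primes := ⟨2, Nat.prime_two⟩
  have h2 : HasProd (fun p : Nat.Primes => if p = two then 1 - (2 : ℂ) ^ (-s) else 1)
      (1 - (2 : ℂ) ^ (-s)) := hasProd_ite_eq two _
  have hL := (((hasProd_LSeriesSB hs).pow 2).mul (hasProd_inertProd hmem)).mul h2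
  have hR := (riemannZeta_eulerProduct_hasProd hs).mul
    (DirichletCharacter.LSeries_eulerProduct_hasProd chi4Char hs)
  rw [LSeries_chi4Char hs] at hR
  refine hL.unique ?_
  convert! hR using 2 with p
  have hx := norm_prime_cpow_neg_lt_one p.2 (zero_lt_one.trans hs)
  have hne (y : ℂ) (hy : ‖y‖ < 1) : 1 - y ≠ 0 := by
    intro h
    rw [← sub_eq_zero.1 h] at hy
    simp at hy
  have hm := hne _ hx
  have hp := hne (-(p : ℂ) ^ (-s)) (by rwa [norm_neg])
  have hpow : (p : ℂ) ^ (-(2 * s)) = ((p : ℂ) ^ (-s)) ^ 2 := by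
    rw [← Complex.cpow_nat_mul]
    congr 1
    push_cast
    ring
  rw [chi4Char_natCast, inertTerm, hpow]
  by_cases hp2 : p = two
  · have hp2' : (p : ℕ) = 2 := by rw [hp2]
    rw [if_pos hp2]
    simp only [hp2', chi4, Nat.cast_ofNat] at hm ⊢
    norm_num
    field_simp
  have hodd : (p : ℕ) % 2 = 1 := p.2.eq_two_or_odd.resolve_left fun h => hp2 (Subtype.ext h)
  generalize (p : ℂ) ^ (-s) = x at *
  rw [if_neg hp2]
  by_cases h3 : (p : ℕ) % 4 = 3
  · have h4 : 1 - x ^ 2 = (1 - x) * (1 - -x) := by ring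
    simp only [chi4, h3, if_true, OfNat.ofNat_ne_one, if_false, Complex.ofReal_neg,
      Complex.ofReal_one, neg_one_mul, ← sub_eq_add_neg, h4, mul_one]
    field_simp
  · have h1 : (p : ℕ) % 4 = 1 := by omega
    simp only [chi4, h1, if_true, OfNat.one_ne_ofNat, if_false, Complex.ofReal_one, one_mul,
      add_zero, mul_one]
    rw [inv_pow, sq, mul_inv]

lemma LSeriesSB_ne_zero {s : ℂ} (hs : 1 < s.re) : LSeriesSB s ≠ 0 := by
  intro h
  have := LSeriesSB_sq_mul hs
  rw [h, zero_pow two_ne_zero, zero_mul, zero_mul] at this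
  exact mul_ne_zero (riemannZeta_ne_zero_of_one_lt_re hs) (dirichletBeta_ne_zero hs) this.symm

lemma hasDerivAt_one_sub_two_cpow_neg (s : ℂ) :
    HasDerivAt (fun s : ℂ => 1 - (2 : ℂ) ^ (-s)) (Real.log 2 * (2 : ℂ) ^ (-s)) s := by
  simpa using (hasDerivAt_natCast_cpow_neg two_ne_zero s).const_sub 1

lemma one_sub_two_cpow_neg_ne_zero {s : ℂ} (hs : 0 < s.re) : 1 - (2 : ℂ) ^ (-s) ≠ 0 := by
  intro h
  have := norm_prime_cpow_neg_lt_one Nat.prime_two hs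
  rw [Nat.cast_ofNat, ← sub_eq_zero.1 h, norm_one] at this
  exact this.false

lemma logDeriv_LSeriesSB {s : ℂ} (hs : 1 < s.re) (hsβ : s ∈ betaRegion) :
    logDeriv LSeriesSB s = (logDeriv riemannZeta s + logDeriv dirichletBeta s -
      logDeriv inertProd s - logDeriv (fun s => 1 - (2 : ℂ) ^ (-s)) s) / 2 := by
  have hmem : s ∈ inertRegion := by
    change 3 / 4 < s.re
    linarith
  have hF := differentiableAt_LSeriesSB hs
  have hP := differentiableOn_inertProd.differentiableAt (isOpen_inertRegion.mem_nhds hmem)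
  have hD := differentiableOn_dirichletBeta.differentiableAt (isOpen_betaRegion.mem_nhds hsβ)
  have hZ : DifferentiableAt ℂ riemannZeta s :=
    differentiableAt_riemannZeta fun h => by simp [h] at hs
  have hT := (hasDerivAt_one_sub_two_cpow_neg s).differentiableAt
  have hF0 := LSeriesSB_ne_zero hs
  have hP0 := inertProd_ne_zero hmem
  have hT0 := one_sub_two_cpow_neg_ne_zero (zero_lt_one.trans hs)
  have heq : (fun s => LSeriesSB s ^ 2 * inertProd s * (1 - (2 : ℂ) ^ (-s))) =ᶠ[𝓝 s]
      fun s => riemannZeta s * dirichletBeta s := by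
    filter_upwards [(isOpen_lt continuous_const Complex.continuous_re).mem_nhds hs] with z hz
    exact LSeriesSB_sq_mul hz
  have h := (logDeriv_congr_nhds heq).eq_of_nhds
  rw [logDeriv_mul (f := fun s => LSeriesSB s ^ 2 * inertProd s) s
      (mul_ne_zero (pow_ne_zero 2 hF0) hP0) hT0 ((hF.pow 2).mul hP) hT,
    logDeriv_mul (f := fun s => LSeriesSB s ^ 2) s (pow_ne_zero 2 hF0) hP0 (hF.pow 2) hP,
    logDeriv_fun_pow hF,
    logDeriv_mul s (riemannZeta_ne_zero_of_one_lt_re hs) (dirichletBeta_ne_zero hs) hZ hD] at h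
  rw [← h]
  push_cast
  ring

lemma continuousAt_logDeriv {f : ℂ → ℂ} {U : Set ℂ} (hU : IsOpen U) (hf : DifferentiableOn ℂ f U)
    {z : ℂ} (hz : z ∈ U) (h0 : f z ≠ 0) : ContinuousAt (logDeriv f) z := by
  have h := hf.analyticAt (hU.mem_nhds hz)
  exact h.deriv.continuousAt.div h.continuousAt h0

lemma logDeriv_one_sub_two_cpow_neg_one :
    logDeriv (fun s : ℂ => 1 - (2 : ℂ) ^ (-s)) 1 = Real.log 2 := by
  rw [logDeriv_apply, (hasDerivAt_one_sub_two_cpow_neg 1).deriv, Complex.cpow_neg_one]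
  norm_num

lemma tendsto_logDeriv_LSeriesSB :
    Tendsto (fun s : ℝ => logDeriv LSeriesSB s + ((1 / 2 / (s - 1) : ℝ) : ℂ)) (𝓝[>] 1)
      (𝓝 ((Real.eulerMascheroniConstant + logDeriv dirichletBeta 1 - logDeriv inertProd 1 -
        Real.log 2) / 2)) := by
  have hcast : Tendsto (fun s : ℝ => (s : ℂ)) (𝓝[>] 1) (𝓝[≠] 1) := by
    refine tendsto_nhdsWithin_iff.2 ⟨?_, ?_⟩
    · exact (Complex.continuous_ofReal.tendsto' 1 1 Complex.ofReal_one).mono_left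
        nhdsWithin_le_nhds
    · filter_upwards [self_mem_nhdsWithin] with s hs
      have : s ≠ 1 := ne_of_gt hs
      simpa using this
  have hcast' := hcast.mono_right nhdsWithin_le_nhds
  have hZ : Tendsto (fun s : ℂ => logDeriv riemannZeta s + (s - 1)⁻¹) (𝓝[≠] 1)
      (𝓝 Real.eulerMascheroniConstant) := by
    have h := (Asymptotics.isLittleO_one_iff ℂ).1 log_deriv_riemannZeta_add_inv_sub_sub_isLittleO
    simpa [logDeriv_apply] using h.add_const (Real.eulerMascheroniConstant : ℂ)
  have hD := continuousAt_logDeriv isOpen_betaRegion differentiableOn_dirichletBeta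
    one_mem_betaRegion dirichletBeta_one_ne_zero
  have hP := continuousAt_logDeriv isOpen_inertRegion differentiableOn_inertProd
    one_mem_inertRegion (inertProd_ne_zero one_mem_inertRegion)
  have hT := continuousAt_logDeriv isOpen_univ (z := 1)
    (fun s _ => (hasDerivAt_one_sub_two_cpow_neg s).differentiableAt.differentiableWithinAt)
    (Set.mem_univ _) (one_sub_two_cpow_neg_ne_zero (by simp))
  rw [ContinuousAt, logDeriv_one_sub_two_cpow_neg_one] at hT
  refine (((((hZ.comp hcast).add (hD.tendsto.comp hcast')).sub (hP.tendsto.comp hcast')).sub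
    (hT.comp hcast')).div_const 2).congr' ?_
  filter_upwards [self_mem_nhdsWithin,
    hcast'.eventually_mem (isOpen_betaRegion.mem_nhds one_mem_betaRegion)] with s hs hsβ
  have hs' : 1 < (s : ℂ).re := hs
  rw [logDeriv_LSeriesSB hs' hsβ]
  simp only [Function.comp_apply]
  push_cast
  ring

lemma LSeriesSB_ofReal (s : ℝ) : LSeriesSB s = LSeries' SB s := by
  rw [LSeriesSB, LSeries, LSeries', Complex.ofReal_tsum]
  refine tsum_congr fun n => ?_
  rw [term_SB]
  split_ifs
  · rw [Complex.ofReal_cpow n.cast_nonneg]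
    simp
  · simp

lemma deriv_div_LSeries_SB {s : ℝ} (hs : 1 < s) :
    deriv (LSeries' SB) s / LSeries' SB s = (logDeriv LSeriesSB s).re := by
  have h := (differentiableAt_LSeriesSB (s := (s : ℂ)) hs).hasDerivAt.real_of_complex
  have hfun : (fun x : ℝ => (LSeriesSB x).re) = LSeries' SB := by
    ext x
    rw [LSeriesSB_ofReal, Complex.ofReal_re]
  rw [hfun] at h
  rw [h.deriv, logDeriv_apply, LSeriesSB_ofReal, Complex.div_ofReal_re]

lemma isEulerKronecker_SB : IsEulerKronecker SB (1 / 2)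
    (Real.eulerMascheroniConstant / 2 +
      (1 / 2) * ((deriv dirichletBeta 1).re / (dirichletBeta 1).re) - Real.log 2 / 2 -
        ∑' p : {p : ℕ // p.Prime ∧ p % 4 = 3}, Real.log p / ((p : ℝ) ^ 2 - 1)) := by
  have h := (Complex.continuous_re.tendsto _).comp tendsto_logDeriv_LSeriesSB
  rw [logDeriv_inertProd_one, logDeriv_apply, ← ofReal_re_deriv_dirichletBeta_one,
    ← ofReal_re_dirichletBeta_one] at h
  generalize (∑' p : {p : ℕ // p.Prime ∧ p % 4 = 3}, Real.log p / ((p : ℝ) ^ 2 - 1)) = S at h ⊢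
  norm_cast at h
  unfold IsEulerKronecker
  convert! h.congr' ?_ using 2
  · ring
  · filter_upwards [self_mem_nhdsWithin] with s hs
    rw [deriv_div_LSeries_SB hs, Function.comp_apply, Complex.add_re, Complex.ofReal_re]

/-- Shanks' formula: the Euler–Kronecker constant `γ_{S_B}` of the sums of two squares
(with density `1/2`) exists and equals
`γ/2 + (1/2) (L'/L)(1,χ₋₄) - (log 2)/2 - ∑_{p ≡ 3 (4)} log p / (p² - 1)`,
where `L = L(1,χ₋₄)` and `L' = L'(1,χ₋₄)` are the limits of the partial sums of the
(conditionally convergent) series `∑ χ₋₄(n)/n` and `-∑ χ₋₄(n) log n / n`, and the sum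
over primes `p ≡ 3 (mod 4)` converges absolutely. -/
theorem shanks_formula :
    ∃ γSB L L' : ℝ,
      Tendsto (fun N : ℕ => ∑ n ∈ Finset.range N, chi4 n / (n : ℝ)) atTop (nhds L) ∧
      Tendsto (fun N : ℕ => -∑ n ∈ Finset.range N, chi4 n * Real.log n / (n : ℝ))
        atTop (nhds L') ∧
      IsEulerKronecker SB (1 / 2) γSB ∧
      Summable (fun p : {p : ℕ // p.Prime ∧ p % 4 = 3} =>
        Real.log p / ((p : ℝ) ^ 2 - 1)) ∧
      γSB = Real.eulerMascheroniConstant / 2 + (1 / 2) * (L' / L) - Real.log 2 / 2 -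
        ∑' p : {p : ℕ // p.Prime ∧ p % 4 = 3}, Real.log p / ((p : ℝ) ^ 2 - 1) := by
  refine ⟨_, _, _, tendsto_sum_chi4_div, tendsto_neg_sum_chi4_mul_log_div, isEulerKronecker_SB,
    ?_, rfl⟩
  exact summable_log_div_sq_sub_one.subtype {p : ℕ | p.Prime ∧ p % 4 = 3}
end
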